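/- arXiv:2407.03366 — 3 statements merged into one kernel-verified Lean document; each statement's English description precedes it below -/
import Mathlib

section
/- Let n ≥ 2, ρ = (n−1)/2, and let λ be either purely imaginary with nonnegative imaginary part or real with 0 < λ < ρ. Let y ∈ dS^n lie outside the closed light cone of eₙ, i.e. yₙ < 1. Then for every t ∈ (0, π/2) the number (1+[z_t, y])/2 lies in ℂ∖[1,∞), and lim_{t→π/2⁻} F_λ((1+[z_t, y])/2) = F_λ((1+yₙ)/2); i.e. the boundary value Ψ^λ of the kernel Ψ_λ along the curve z_t is the real-analytic function F_λ((1+yₙ)/2) off the light cone of eₙ. -/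
open scoped BigOperators
open Filter Topology

noncomputable section

/-- The Lorentzian bilinear form on `ℝ^{1+n}`. -/
def lformR (n : ℕ) (x y : Fin (n+1) → ℝ) : ℝ :=
  ∑ i, (if i = 0 then (-1 : ℝ) else 1) * x i * y i

/-- The complex-bilinear Lorentzian form on `ℂ^{1+n}`. -/
def lformC (n : ℕ) (z w : Fin (n+1) → ℂ) : ℂ :=
  ∑ i, (if i = 0 then (-1 : ℂ) else 1) * z i * w i

/-- The matrix `η = diag(−1,1,…,1)`. -/
def eta (n : ℕ) : Matrix (Fin (n+1)) (Fin (n+1)) ℝ :=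
  Matrix.diagonal (fun i => if i = 0 then (-1 : ℝ) else 1)

/-- Membership in `G = SO(1,n)_e`. -/
def memG (n : ℕ) (g : Matrix (Fin (n+1)) (Fin (n+1)) ℝ) : Prop :=
  g.transpose * eta n * g = eta n ∧ g.det = 1 ∧ 0 < g 0 0

/-- Standard basis vector `e₀`. -/
def e0 (n : ℕ) : Fin (n+1) → ℝ := fun i => if i = 0 then 1 else 0

/-- Standard basis vector `eₙ`. -/
def elast (n : ℕ) : Fin (n+1) → ℝ := fun i => if i = Fin.last n then 1 else 0

/-- Membership in `H = SO(1,n−1)_e`, the stabilizer of `eₙ`. -/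
def memH (n : ℕ) (g : Matrix (Fin (n+1)) (Fin (n+1)) ℝ) : Prop :=
  memG n g ∧ g.mulVec (elast n) = elast n

/-- Membership in `K = SO(n)`, the stabilizer of `e₀`. -/
def memK (n : ℕ) (g : Matrix (Fin (n+1)) (Fin (n+1)) ℝ) : Prop :=
  memG n g ∧ g.mulVec (e0 n) = e0 n

/-- The boost `a_t`. -/
def boost (n : ℕ) (t : ℝ) : Matrix (Fin (n+1)) (Fin (n+1)) ℝ :=
  Matrix.of fun i j =>
    if i = 0 ∧ j = 0 then Real.cosh t
    else if i = Fin.last n ∧ j = Fin.last n then Real.cosh t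
    else if (i = 0 ∧ j = Fin.last n) ∨ (i = Fin.last n ∧ j = 0) then Real.sinh t
    else if i = j then 1 else 0

/-- The upper hemisphere `S^n_+ = {(ix₀, 𝐱) : x₀ > 0, x₀² + |𝐱|² = 1}` in `ℂ^{1+n}`. -/
def Snplus (n : ℕ) : Set (Fin (n+1) → ℂ) :=
  {z | ∃ x : Fin (n+1) → ℝ, 0 < x 0 ∧ (∑ i, (x i)^2) = 1 ∧
    z 0 = Complex.I * (x 0 : ℂ) ∧ ∀ i, i ≠ 0 → z i = (x i : ℂ)}

/-- The crown domain `Ξ = G · S^n_+ ⊂ ℂ^{1+n}`. -/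
def Xi (n : ℕ) : Set (Fin (n+1) → ℂ) :=
  {z | ∃ g w, memG n g ∧ w ∈ Snplus n ∧ z = (g.map (Complex.ofReal)).mulVec w}

/-- The conjugate crown `Ξ̄`. -/
def XiBar (n : ℕ) : Set (Fin (n+1) → ℂ) :=
  {z | (fun i => (starRingEnd ℂ) (z i)) ∈ Xi n}

/-- The de Sitter space `dS^n` viewed inside `ℂ^{1+n}`. -/
def dSC (n : ℕ) : Set (Fin (n+1) → ℂ) :=
  {z | (∀ i, (z i).im = 0) ∧ lformC n z z = 1}

/-- The cut `[1,∞) ⊂ ℂ`. -/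
def slit : Set ℂ := {z | z.im = 0 ∧ 1 ≤ z.re}

/-- Componentwise complex conjugation on `ℂ^{1+n}`. -/
def conjVec (n : ℕ) (z : Fin (n+1) → ℂ) : Fin (n+1) → ℂ :=
  fun i => (starRingEnd ℂ) (z i)

/-- `λ` is admissible: purely imaginary with nonnegative imaginary part, or
real with `0 < λ < ρ = (n−1)/2`. -/
def admissible (n : ℕ) (lam : ℂ) : Prop :=
  (lam.re = 0 ∧ 0 ≤ lam.im) ∨ (lam.im = 0 ∧ 0 < lam.re ∧ lam.re < ((n : ℝ) - 1)/2)

/-- Euler's integral representation of `₂F₁(ρ+λ, ρ−λ; n/2; ·)` on `ℂ∖[1,∞)`,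
with `ρ = (n−1)/2`. -/
def Flam (n : ℕ) (lam : ℂ) (z : ℂ) : ℂ :=
  (Complex.Gamma ((n : ℂ)/2) /
    (Complex.Gamma (((n : ℂ) - 1)/2 - lam) * Complex.Gamma (1/2 + lam))) *
  ∫ t in (0:ℝ)..1, (t : ℂ) ^ (((n : ℂ) - 1)/2 - lam - 1) *
    ((1 : ℂ) - (t : ℂ)) ^ (lam - 1/2) *
    ((1 : ℂ) - z * (t : ℂ)) ^ (-(((n : ℂ) - 1)/2) - lam)

/-- General term of the Gauss hypergeometric series `₂F₁(a,b;c;w)`. -/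
def hypTerm (a b c : ℂ) (w : ℂ) (k : ℕ) : ℂ :=
  (ascPochhammer ℂ k).eval a * (ascPochhammer ℂ k).eval b /
    ((ascPochhammer ℂ k).eval c * (k.factorial : ℂ)) * w ^ k

/-- The curve `z_t = (i cos t, 0, …, 0, sin t)` in the crown `Ξ`. -/
def zCurve (n : ℕ) (t : ℝ) : Fin (n+1) → ℂ :=
  fun i => if i = 0 then Complex.I * (Real.cos t : ℂ)
    else if i = Fin.last n then (Real.sin t : ℂ) else 0

/-- The curve `z̃_t = (−i cos t, 0, …, 0, sin t)` in the conjugate crown `Ξ̄`. -/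
def zCurveBar (n : ℕ) (t : ℝ) : Fin (n+1) → ℂ :=
  fun i => if i = 0 then -Complex.I * (Real.cos t : ℂ)
    else if i = Fin.last n then (Real.sin t : ℂ) else 0

/-- The open future cone `Γ⁺(eₙ)` in `dS^n`. -/
def futureCone (n : ℕ) : Set (Fin (n+1) → ℝ) :=
  {y | lformR n y y = 1 ∧ lformR n (y - elast n) (y - elast n) < 0 ∧ 0 < y 0}

/-- The open past cone `Γ⁻(eₙ)` in `dS^n`. -/
def pastCone (n : ℕ) : Set (Fin (n+1) → ℝ) :=
  {y | lformR n y y = 1 ∧ lformR n (y - elast n) (y - elast n) < 0 ∧ y 0 < 0}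


/-- The boundary value expression in Statement 12 (sign `s = ∓1` for `x ± i0`). -/
def bval (n : ℕ) (lam : ℂ) (x : ℝ) (s : ℝ) : ℂ :=
  (Complex.Gamma ((n : ℂ)/2) * Complex.Gamma ((2 - (n : ℂ))/2) /
      (Complex.Gamma (1/2 + lam) * Complex.Gamma (1/2 - lam))) *
    ∑' k : ℕ, hypTerm (((n : ℂ) - 1)/2 + lam) (((n : ℂ) - 1)/2 - lam) ((n : ℂ)/2)
      ((1 : ℂ) - x) k
  + Complex.exp ((s : ℂ) * (Real.pi : ℂ) * Complex.I * ((2 - (n : ℂ))/2)) *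
      (((x - 1) ^ ((2 - (n : ℝ))/2) : ℝ) : ℂ) *
      (Complex.Gamma ((n : ℂ)/2) * Complex.Gamma (((n : ℂ) - 2)/2) /
        (Complex.Gamma (((n : ℂ) - 1)/2 + lam) * Complex.Gamma (((n : ℂ) - 1)/2 - lam))) *
    ∑' k : ℕ, hypTerm (1/2 - lam) (1/2 + lam) ((4 - (n : ℂ))/2) ((1 : ℂ) - x) k

end

/-- The integrand of Euler's integral stays off the branch cut when `z.re < 1`. -/
theorem one_sub_mul_ofReal_mem_slitPlane {z : ℂ} (hz : z.re < 1) {t : ℝ}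
    (ht : t ∈ Set.Icc (0 : ℝ) 1) : (1 : ℂ) - z * (t : ℂ) ∈ Complex.slitPlane := by
  refine Or.inl ?_
  simp only [Complex.sub_re, Complex.one_re, Complex.re_mul_ofReal]
  rcases ht.1.eq_or_lt with h | h
  · simp [← h]
  · nlinarith [ht.2]

/-- Parametric Euler integrals are continuous in `z` on the half-plane `z.re < 1`. -/
theorem continuousAt_euler_integral {u v : ℂ} (hu : 0 < u.re) (hv : 0 < v.re) (s : ℂ)
    {w : ℂ} (hw : w.re < 1) :
    ContinuousAt (fun z : ℂ => ∫ t in (0:ℝ)..1, (t : ℂ) ^ (u - 1) *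
      ((1 : ℂ) - (t : ℂ)) ^ (v - 1) * ((1 : ℂ) - z * (t : ℂ)) ^ s) w := by
  have hre : ∀ z ∈ Metric.closedBall w ((1 - w.re) / 2), z.re < 1 := by
    intro z hz
    have h := (Complex.abs_re_le_norm (z - w)).trans (mem_closedBall_iff_norm.1 hz)
    rw [Complex.sub_re] at h
    linarith [le_abs_self (z.re - w.re)]
  have hcont : ContinuousOn (fun p : ℂ × ℝ => ((1 : ℂ) - p.1 * (p.2 : ℂ)) ^ s)
      (Metric.closedBall w ((1 - w.re) / 2) ×ˢ Set.Icc (0 : ℝ) 1) :=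
    ContinuousOn.cpow_const (by fun_prop)
      fun p hp => one_sub_mul_ofReal_mem_slitPlane (hre _ hp.1) hp.2
  obtain ⟨C, hC⟩ := ((isCompact_closedBall w ((1 - w.re) / 2)).prod
    isCompact_Icc).exists_bound_of_continuousOn hcont
  have hnhds : Metric.closedBall w ((1 - w.re) / 2) ∈ 𝓝 w :=
    Metric.closedBall_mem_nhds w (by linarith)
  have hsub : ∀ {t : ℝ}, t ∈ Set.uIoc (0 : ℝ) 1 → t ∈ Set.Icc (0 : ℝ) 1 := fun h =>
    Set.Ioc_subset_Icc_self (by rwa [Set.uIoc_of_le zero_le_one] at h)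
  have hbeta := Complex.betaIntegral_convergent hu hv
  refine intervalIntegral.continuousAt_of_dominated_interval
    (bound := fun t => ‖(t : ℂ) ^ (u - 1) * ((1 : ℂ) - (t : ℂ)) ^ (v - 1)‖ * C)
    ?_ ?_ (hbeta.norm.mul_const C) ?_
  · filter_upwards [hnhds] with z hz
    refine hbeta.def'.aestronglyMeasurable.mul
      (ContinuousOn.aestronglyMeasurable ?_ measurableSet_uIoc)
    exact hcont.comp (f := fun t : ℝ => (z, t)) (by fun_prop) fun t ht => ⟨hz, hsub ht⟩
  · filter_upwards [hnhds] with z hz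
    refine Eventually.of_forall fun t ht => ?_
    rw [norm_mul]
    exact mul_le_mul_of_nonneg_left (hC (z, t) ⟨hz, hsub ht⟩) (norm_nonneg _)
  · refine Eventually.of_forall fun t ht => ContinuousAt.mul continuousAt_const ?_
    exact ContinuousAt.cpow (by fun_prop) continuousAt_const
      (one_sub_mul_ofReal_mem_slitPlane hw (hsub ht))

theorem continuousAt_Flam {n : ℕ} (hn : 2 ≤ n) {lam : ℂ} (hlam : admissible n lam)
    {w : ℂ} (hw : w.re < 1) : ContinuousAt (Flam n lam) w := by
  have hn' : (2 : ℝ) ≤ n := by exact_mod_cast hn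
  have hdim : (((n : ℂ) - 1) / 2).re = ((n : ℝ) - 1) / 2 := by
    simp
  have hu : 0 < (((n : ℂ) - 1) / 2 - lam).re := by
    rw [Complex.sub_re, hdim]
    rcases hlam with h | h <;> linarith [h.1, h.2]
  have hv : 0 < (lam + 1 / 2).re := by
    have hhalf : (1 / 2 : ℂ).re = 1 / 2 := by norm_num
    rw [Complex.add_re, hhalf]
    rcases hlam with h | h <;> linarith [h.1, h.2]
  have h := continuousAt_euler_integral hu hv (-(((n : ℂ) - 1) / 2) - lam) hw
  rw [show lam + 1 / 2 - 1 = lam - 1 / 2 by ring] at h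
  exact continuousAt_const.mul h

theorem lformC_zCurve {n : ℕ} (hn : 1 ≤ n) (t : ℝ) (w : Fin (n+1) → ℂ) :
    lformC n (zCurve n t) w =
      -(Complex.I * (Real.cos t : ℂ) * w 0) + (Real.sin t : ℂ) * w (Fin.last n) := by
  obtain ⟨m, rfl⟩ := Nat.exists_eq_add_of_le' hn
  have hne : ∀ j : Fin m, (Fin.castSucc j).succ ≠ Fin.last (m + 1) := fun j => by
    rw [← Fin.succ_last]
    exact fun h => (Fin.castSucc_lt_last j).ne (Fin.succ_injective _ h)
  simp only [lformC, zCurve]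
  rw [Fin.sum_univ_succ, Fin.sum_univ_castSucc]
  simp [hne, Fin.succ_ne_zero]

open Filter Topology in
theorem stmt15 (n : ℕ) (hn : 2 ≤ n) (lam : ℂ) (hlam : admissible n lam)
    (y : Fin (n+1) → ℝ) (hy : lformR n y y = 1) (hyn : y (Fin.last n) < 1) :
    (∀ t ∈ Set.Ioo (0 : ℝ) (Real.pi/2),
      (1 + lformC n (zCurve n t) (fun i => (y i : ℂ)))/2 ∉ slit) ∧
    Tendsto (fun t : ℝ => Flam n lam ((1 + lformC n (zCurve n t) (fun i => (y i : ℂ)))/2))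
      (𝓝[<] (Real.pi/2))
      (𝓝 (Flam n lam ((1 + (y (Fin.last n) : ℂ))/2))) := by
  have hform : ∀ t : ℝ, lformC n (zCurve n t) (fun i => (y i : ℂ)) =
      -(Complex.I * (Real.cos t : ℂ) * (y 0 : ℂ)) + (Real.sin t : ℂ) * (y (Fin.last n) : ℂ) :=
    fun t => lformC_zCurve (by lia) t _
  simp only [hform]
  constructor
  · rintro t ⟨ht0, ht1⟩ ⟨-, h⟩
    have hs0 : 0 < Real.sin t := Real.sin_pos_of_pos_of_lt_pi ht0 (by linarith [Real.pi_pos])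
    rw [Complex.div_ofNat_re] at h
    simp only [Complex.add_re, Complex.neg_re, Complex.one_re, mul_assoc, Complex.I_mul_re,
      ← Complex.ofReal_mul, Complex.ofReal_re, Complex.ofReal_im] at h
    nlinarith [Real.sin_le_one t]
  · have hre : ((1 + (y (Fin.last n) : ℂ)) / 2).re < 1 := by
      rw [Complex.div_ofNat_re, Complex.add_re, Complex.one_re, Complex.ofReal_re]
      linarith
    refine (continuousAt_Flam hn hlam hre).tendsto.comp (tendsto_nhdsWithin_of_tendsto_nhds ?_)
    have hcont : Continuous fun t : ℝ => (1 + (-(Complex.I * (Real.cos t : ℂ) * (y 0 : ℂ)) +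
        (Real.sin t : ℂ) * (y (Fin.last n) : ℂ))) / 2 := by
      fun_prop
    convert hcont.tendsto (Real.pi / 2) using 2
    simp
end

section
/- Let n ≥ 2, ρ = (n−1)/2, and let λ be either purely imaginary with nonnegative imaginary part or real with 0 < λ < ρ. Let y ∈ Γ⁺(eₙ) ∪ Γ⁻(eₙ), and set s = +1 if y₀ > 0 and s = −1 if y₀ < 0. Then for every t ∈ (0, π/2) the number (1+[z̃_t, y])/2 lies in ℂ∖[1,∞), the one-sided limit L̃ = lim_{ε→0⁺} F_λ((1+yₙ)/2 + s·iε) exists, and lim_{t→π/2⁻} F_λ((1+[z̃_t, y])/2) = L̃; i.e. the boundary value Ψ̃^λ from the conjugate crown Ξ̄ equals F_λ((1+yₙ)/2 + i0) in the future cone and F_λ((1+yₙ)/2 − i0) in the past cone of eₙ. -/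
open scoped BigOperators
open Filter Topology

section EulerBoundary

open MeasureTheory Set

/-- If `f` maps the compact interval into the slit plane at parameter `z₀`, an integral weighted by
a power of `f` is continuous in the parameter. -/
theorem tendsto_intervalIntegral_mul_cpow {h : ℝ → ℂ} {f : ℂ → ℝ → ℂ} {a b : ℝ} {z₀ α : ℂ}
    (hh : IntervalIntegrable h volume a b) (hf : Continuous (Function.uncurry f))
    (hs : ∀ t ∈ uIcc a b, f z₀ t ∈ Complex.slitPlane) :
    Tendsto (fun z => ∫ t in a..b, h t * f z t ^ α) (𝓝 z₀)
      (𝓝 (∫ t in a..b, h t * f z₀ t ^ α)) := by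
  have hcont : ∀ t ∈ uIcc a b,
      ContinuousAt (fun q : ℂ × ℝ => f q.1 q.2 ^ α) (z₀, t) := fun t ht =>
    ContinuousAt.cpow (f := fun q : ℂ × ℝ => f q.1 q.2) hf.continuousAt continuousAt_const (hs t ht)
  have hslice : ∀ z, Continuous (f z) := fun z => hf.comp (Continuous.prodMk_right z)
  obtain ⟨M, hM⟩ := (isCompact_uIcc (a := a) (b := b)).exists_bound_of_continuousOn
    (f := fun t => f z₀ t ^ α)
    ((hslice z₀).continuousOn.cpow continuousOn_const hs)
  have hbound : ∀ᶠ z in 𝓝 z₀, ∀ t ∈ uIcc a b, ‖f z t ^ α‖ < M + 1 := by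
    apply isCompact_uIcc.eventually_forall_of_forall_eventually
    intro t ht
    exact (hcont t ht).norm.eventually_lt_const ((hM t ht).trans_lt (lt_add_one M))
  apply intervalIntegral.tendsto_integral_filter_of_dominated_convergence
    (fun t => ‖h t‖ * (M + 1))
  · refine Eventually.of_forall fun z => ?_
    exact hh.aestronglyMeasurable_restrict_uIoc.mul
      (((hslice z).measurable.pow_const α).aestronglyMeasurable)
  · filter_upwards [hbound] with z hz
    refine Eventually.of_forall fun t ht => ?_
    rw [norm_mul]
    exact mul_le_mul_of_nonneg_left (hz t (uIoc_subset_uIcc ht)).le (norm_nonneg _)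
  · exact hh.norm.mul_const _
  · refine Eventually.of_forall fun t ht => ?_
    have := (hcont t (uIoc_subset_uIcc ht)).comp (f := fun z : ℂ => (z, t)) (x := z₀)
      (by fun_prop)
    exact tendsto_const_nhds.mul this

/-- On the open lower half-plane the principal power is, up to a constant, the power of the
rotated variable, whose branch cut lies in the upper half-plane. -/
theorem cpow_eq_rotated {w : ℂ} (hw : w.im < 0) (α : ℂ) :
    w ^ α = (-Complex.I) ^ α * (Complex.I * w) ^ α := by
  have hI : Complex.I * w ≠ 0 := by
    refine mul_ne_zero Complex.I_ne_zero fun h => ?_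
    simp [h] at hw
  have harg : |(Complex.I * w).arg| < Real.pi / 2 := by
    rw [Complex.abs_arg_lt_pi_div_two_iff]; left; simpa using hw
  have h := abs_lt.1 harg
  have hI' : -Complex.I ≠ 0 := neg_ne_zero.2 Complex.I_ne_zero
  have hlog : Complex.log (-Complex.I * (Complex.I * w)) =
      Complex.log (-Complex.I) + Complex.log (Complex.I * w) := by
    refine Complex.log_mul hI' hI ?_
    rw [Complex.arg_neg_I]
    constructor <;> linarith [h.1, h.2, Real.pi_pos]
  have hw' : -Complex.I * (Complex.I * w) = w := by
    linear_combination -w * Complex.I_mul_I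
  have hw0 : w ≠ 0 := right_ne_zero_of_mul hI
  rw [hw'] at hlog
  rw [Complex.cpow_def_of_ne_zero hw0, Complex.cpow_def_of_ne_zero hI',
    Complex.cpow_def_of_ne_zero hI, hlog, add_mul, Complex.exp_add]

theorem rotated_mem_slitPlane {x : ℝ} (hx : 0 < x) {t : ℂ}
    (hne : 0 < t.im ∨ x * t.re ≠ 1) : Complex.I * (1 - (x : ℂ) * t) ∈ Complex.slitPlane := by
  rw [Complex.mem_slitPlane_iff]
  rcases hne with h | h
  · left; simp; positivity
  · right; simpa [sub_eq_zero] using h.symm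

theorem im_one_sub_mul_neg {z t : ℂ} (hz : 0 < z.im) (hz' : 0 < z.re) (ht : 0 ≤ t.im)
    (ht' : 0 < t.re) : (1 - z * t).im < 0 := by
  simp only [Complex.sub_im, Complex.one_im, Complex.mul_im]
  have := mul_pos hz ht'
  have := mul_nonneg hz'.le ht
  linarith

/-- Euler-type integrals have boundary values on the cut, from the upper half-plane. -/
theorem exists_tendsto_euler_integral {β γ : ℂ} (hβ : -1 < β.re) (hγ : -1 < γ.re) (α : ℂ)
    {x : ℝ} (hx : 1 < x) :
    ∃ L : ℂ, Tendsto (fun z : ℂ => ∫ t in (0:ℝ)..1,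
      (t : ℂ) ^ β * ((1 : ℂ) - (t : ℂ)) ^ γ * ((1 : ℂ) - z * (t : ℂ)) ^ α)
      (𝓝[{z | 0 < z.im}] (x : ℂ)) (𝓝 L) := by
  obtain ⟨δ, hδ0, hδx, hδ1⟩ : ∃ δ : ℝ, 0 < δ ∧ x * δ < 1 ∧ 1 < x * (1 - δ) := by
    have hx0 : 0 < x := by linarith
    refine ⟨min (1 / x) (1 - 1 / x) / 2, ?_, ?_, ?_⟩
    · have : 1 / x < 1 := by rw [div_lt_one hx0]; exact hx
      have : 0 < 1 / x := by positivity
      have : 0 < min (1 / x) (1 - 1 / x) := lt_min this (by linarith)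
      linarith
    · have h1 := mul_le_mul_of_nonneg_left (min_le_left (1 / x) (1 - 1 / x)) hx0.le
      rw [mul_one_div_cancel hx0.ne'] at h1
      linarith
    · have h1 := mul_le_mul_of_nonneg_left (min_le_right (1 / x) (1 - 1 / x)) hx0.le
      rw [mul_sub, mul_one_div_cancel hx0.ne'] at h1
      linarith
  have hx0 : 0 < x := by linarith
  have hδlt : δ < 1 - δ := by nlinarith
  set w : ℂ → ℂ := fun t => t ^ β * (1 - t) ^ γ with hw
  set k : ℂ → ℂ → ℂ := fun z t => Complex.I * (1 - z * t) with hk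
  have hkc : Continuous (Function.uncurry k) := by
    simp only [hk]; fun_prop
  have hint : IntervalIntegrable (fun t : ℝ => w t) volume 0 1 := by
    have := Complex.betaIntegral_convergent (u := β + 1) (v := γ + 1)
      (by simp; linarith) (by simp; linarith)
    simpa [hw] using this
  have hwc : ∀ t : ℂ, 0 < t.re → t.re < 1 → ContinuousAt w t ∧ DifferentiableAt ℂ w t := by
    intro t h0 h1
    have h2 : t ∈ Complex.slitPlane := Or.inl h0
    have h3 : 1 - t ∈ Complex.slitPlane := Or.inl (by simpa using h1)
    have : DifferentiableAt ℂ w t :=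
      (differentiableAt_id.cpow_const h2).mul
        (((differentiableAt_const _).sub differentiableAt_id).cpow_const h3)
    exact ⟨this.continuousAt, this⟩
  have hpath : ∀ {p : ℝ → ℂ} {a b : ℝ}, Continuous p →
      IntervalIntegrable (fun t => w (p t)) volume a b →
      (∀ t ∈ uIcc a b, 0 < (p t).im ∨ x * (p t).re ≠ 1) →
      Tendsto (fun z => ∫ t in a..b, w (p t) * k z (p t) ^ α) (𝓝[{z | 0 < z.im}] (x : ℂ))
        (𝓝 (∫ t in a..b, w (p t) * k x (p t) ^ α)) := by
    intro p a b hp hi h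
    refine (tendsto_intervalIntegral_mul_cpow (f := fun z t => k z (p t)) hi ?_ ?_).mono_left
      nhdsWithin_le_nhds
    · exact hkc.comp (continuous_fst.prodMk (hp.comp continuous_snd))
    · exact fun t ht => rotated_mem_slitPlane hx0 (h t ht)
  have hpath' : ∀ {p : ℝ → ℂ} {a b : ℝ}, Continuous p →
      (∀ t ∈ uIcc a b, 0 < (p t).re ∧ (p t).re < 1) →
      (∀ t ∈ uIcc a b, 0 < (p t).im ∨ x * (p t).re ≠ 1) →
      Tendsto (fun z => ∫ t in a..b, w (p t) * k z (p t) ^ α) (𝓝[{z | 0 < z.im}] (x : ℂ))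
        (𝓝 (∫ t in a..b, w (p t) * k x (p t) ^ α)) := by
    intro p a b hp hr h
    refine hpath hp (ContinuousOn.intervalIntegrable fun t ht => ?_) h
    exact ((hwc _ (hr t ht).1 (hr t ht).2).1.comp hp.continuousAt).continuousWithinAt
  have T1 := hpath (p := fun t => (t : ℂ)) (a := 0) (b := δ) (by fun_prop)
    (hint.mono_set (by
      rw [uIcc_of_le hδ0.le, uIcc_of_le zero_le_one]; exact Icc_subset_Icc_right (by linarith)))
    (by
      intro t ht
      rw [uIcc_of_le hδ0.le] at ht
      refine Or.inr ?_
      simp only [Complex.ofReal_re]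
      nlinarith [ht.2])
  have T2 := hpath (p := fun t => (t : ℂ)) (a := 1 - δ) (b := 1) (by fun_prop)
    (hint.mono_set (by
      rw [uIcc_of_le (by linarith), uIcc_of_le zero_le_one]
      exact Icc_subset_Icc_left (by linarith)))
    (by
      intro t ht
      rw [uIcc_of_le (by linarith)] at ht
      refine Or.inr ?_
      simp only [Complex.ofReal_re]
      nlinarith [ht.1])
  have T3 := hpath' (p := fun t => (t : ℂ) + Complex.I) (a := δ) (b := 1 - δ) (by fun_prop)
    (by
      intro t ht
      rw [uIcc_of_le hδlt.le] at ht
      simp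
      constructor <;> linarith [ht.1, ht.2])
    (by intro t ht; simp)
  have T4 := hpath' (p := fun t => ((1 - δ : ℝ) : ℂ) + t * Complex.I) (a := 0) (b := 1)
    (by fun_prop)
    (by
      intro t ht
      simp
      constructor <;> linarith)
    (by
      intro t ht
      refine Or.inr ?_
      simp
      linarith)
  have T5 := hpath' (p := fun t => (δ : ℂ) + t * Complex.I) (a := 0) (b := 1)
    (by fun_prop)
    (by
      intro t ht
      simp
      constructor <;> linarith)
    (by
      intro t ht
      refine Or.inr ?_
      simp
      linarith)
  have T := ((((T1.add T3).sub (T4.const_smul Complex.I)).add (T5.const_smul Complex.I)).add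
    T2).const_mul ((-Complex.I) ^ α)
  refine ⟨_, T.congr' ?_⟩
  have hre : ∀ᶠ z in 𝓝[{z | 0 < z.im}] (x : ℂ), 0 < z.re :=
    nhdsWithin_le_nhds (Complex.continuous_re.continuousAt.eventually_const_lt (by simpa using hx0))
  filter_upwards [self_mem_nhdsWithin, hre] with z hz hzr
  have hz : 0 < z.im := hz
  have hkslit : ∀ t : ℂ, 0 ≤ t.im → 0 < t.re → k z t ∈ Complex.slitPlane := by
    intro t h0 h1
    left
    simpa only [hk, Complex.I_mul_re, neg_pos] using im_one_sub_mul_neg hz hzr h0 h1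
  have hkslit' : ∀ t : ℝ, 0 ≤ t → k z t ∈ Complex.slitPlane := by
    intro t ht
    rcases ht.eq_or_lt with rfl | ht
    · simp [hk, Complex.mem_slitPlane_iff]
    · exact hkslit t (by simp) (by simpa using ht)
  have hfint : IntervalIntegrable (fun t : ℝ => w t * k z t ^ α) volume 0 1 := by
    refine hint.mul_continuousOn ?_
    refine ContinuousOn.cpow (by simp only [hk]; fun_prop) continuousOn_const ?_
    intro t ht
    rw [uIcc_of_le zero_le_one] at ht
    exact hkslit' t ht.1
  have hsub : ∀ {a b : ℝ}, 0 ≤ a → a ≤ b → b ≤ 1 →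
      IntervalIntegrable (fun t : ℝ => w t * k z t ^ α) volume a b := by
    intro a b h0 hab h1
    refine hfint.mono_set ?_
    rw [uIcc_of_le hab, uIcc_of_le zero_le_one]
    exact Icc_subset_Icc h0 h1
  have hdiff : ∀ t : ℂ, 0 ≤ t.im → 0 < t.re → t.re < 1 →
      DifferentiableAt ℂ (fun t => w t * k z t ^ α) t := by
    intro t h0 h1 h2
    refine (hwc t h1 h2).2.mul (DifferentiableAt.cpow_const ?_ (hkslit t h0 h1))
    simp only [hk]; fun_prop
  have hrect := Complex.integral_boundary_rect_eq_zero_of_differentiableOn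
    (fun t => w t * k z t ^ α) (δ : ℂ) (((1 - δ : ℝ) : ℂ) + Complex.I) (by
      intro t ht
      rw [Complex.mem_reProdIm] at ht
      simp [uIcc_of_le hδlt.le] at ht
      exact (hdiff t ht.2.1 (by linarith [ht.1.1]) (by linarith [ht.1.2])).differentiableWithinAt)
  have hsplit : ∫ t in (0:ℝ)..1, w t * k z t ^ α = (∫ t in (0:ℝ)..δ, w t * k z t ^ α) +
      (∫ t in δ..(1 - δ), w t * k z t ^ α) + ∫ t in (1 - δ)..1, w t * k z t ^ α := by
    rw [intervalIntegral.integral_add_adjacent_intervals,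
      intervalIntegral.integral_add_adjacent_intervals]
    all_goals apply hsub <;> linarith
  have hrot : ∫ t in (0:ℝ)..1, (t : ℂ) ^ β * ((1 : ℂ) - (t : ℂ)) ^ γ *
      ((1 : ℂ) - z * (t : ℂ)) ^ α =
      (-Complex.I) ^ α * ∫ t in (0:ℝ)..1, w t * k z t ^ α := by
    rw [← intervalIntegral.integral_const_mul]
    refine intervalIntegral.integral_congr_ae (Eventually.of_forall fun t ht => ?_)
    rw [uIoc_of_le zero_le_one] at ht
    simp only [hw, hk]
    rw [cpow_eq_rotated (im_one_sub_mul_neg hz hzr (by simp) (by simpa using ht.1))]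
    ring
  rw [hrot, hsplit]
  congr 1
  simp at hrect ⊢
  linear_combination -hrect

theorem conj_euler_integral {α β γ z : ℂ} (hz : z.im ≠ 0) :
    ∫ t in (0:ℝ)..1, (t : ℂ) ^ β * ((1 : ℂ) - (t : ℂ)) ^ γ * ((1 : ℂ) - z * (t : ℂ)) ^ α =
      (starRingEnd ℂ) (∫ t in (0:ℝ)..1, (t : ℂ) ^ (starRingEnd ℂ β) *
        ((1 : ℂ) - (t : ℂ)) ^ (starRingEnd ℂ γ) *
        ((1 : ℂ) - (starRingEnd ℂ z) * (t : ℂ)) ^ (starRingEnd ℂ α)) := by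
  rw [intervalIntegral.integral_of_le zero_le_one, intervalIntegral.integral_of_le zero_le_one,
    ← integral_conj]
  refine setIntegral_congr_fun measurableSet_Ioc fun t ht => ?_
  have h1 : (t : ℂ).arg ≠ Real.pi := by
    rw [Complex.arg_ofReal_of_nonneg ht.1.le]; exact Real.pi_pos.ne
  have h2 : (1 - (t : ℂ)).arg ≠ Real.pi := by
    rw [← Complex.ofReal_one, ← Complex.ofReal_sub,
      Complex.arg_ofReal_of_nonneg (by linarith [ht.2])]
    exact Real.pi_pos.ne
  have h3 : (1 - (starRingEnd ℂ z) * (t : ℂ)).arg ≠ Real.pi := by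
    refine (Complex.mem_slitPlane_iff_arg.1 (Or.inr ?_)).1
    simpa using ⟨hz, ht.1.ne'⟩
  simp only [map_mul]
  rw [← Complex.conj_cpow _ _ h1, ← Complex.conj_cpow _ _ h2, ← Complex.conj_cpow _ _ h3]
  simp

theorem exists_tendsto_euler_integral_lower {β γ : ℂ} (hβ : -1 < β.re) (hγ : -1 < γ.re) (α : ℂ)
    {x : ℝ} (hx : 1 < x) :
    ∃ L : ℂ, Tendsto (fun z : ℂ => ∫ t in (0:ℝ)..1,
      (t : ℂ) ^ β * ((1 : ℂ) - (t : ℂ)) ^ γ * ((1 : ℂ) - z * (t : ℂ)) ^ α)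
      (𝓝[{z | z.im < 0}] (x : ℂ)) (𝓝 L) := by
  obtain ⟨L, hL⟩ := exists_tendsto_euler_integral (β := starRingEnd ℂ β) (γ := starRingEnd ℂ γ)
    (by simpa) (by simpa) (starRingEnd ℂ α) hx
  have hconj : Tendsto (starRingEnd ℂ) (𝓝[{z | z.im < 0}] (x : ℂ)) (𝓝[{z | 0 < z.im}] (x : ℂ)) := by
    refine tendsto_nhdsWithin_iff.2 ⟨?_, ?_⟩
    · have := (Complex.continuous_conj.tendsto (x : ℂ)).mono_left
        (nhdsWithin_le_nhds (s := {z : ℂ | z.im < 0}))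
      simpa using this
    · filter_upwards [self_mem_nhdsWithin] with z hz
      simpa using hz
  refine ⟨starRingEnd ℂ L, (((Complex.continuous_conj.tendsto L).comp hL).comp hconj).congr' ?_⟩
  filter_upwards [self_mem_nhdsWithin] with z hz
  exact (conj_euler_integral (ne_of_lt hz)).symm

/-- `F_λ` has boundary values on the cut from each of the half-planes `0 < s * Im z`. -/
theorem exists_tendsto_Flam {n : ℕ} {lam : ℂ} (hn : 2 ≤ n) (hlam : admissible n lam)
    {x s : ℝ} (hx : 1 < x) (hs : s = 1 ∨ s = -1) :
    ∃ L : ℂ, Tendsto (Flam n lam) (𝓝[{z | 0 < s * z.im}] (x : ℂ)) (𝓝 L) := by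
  have hn' : (2 : ℝ) ≤ n := by exact_mod_cast hn
  have hre : -1 / 2 < lam.re ∧ lam.re < ((n : ℝ) - 1) / 2 := by
    rcases hlam with h | h
    · rw [h.1]; constructor <;> linarith
    · exact ⟨by linarith [h.2.1], h.2.2⟩
  have hβ : -1 < (((n : ℂ) - 1) / 2 - lam - 1).re := by
    have : (((n : ℂ) - 1) / 2 - lam - 1).re = ((n : ℝ) - 1) / 2 - lam.re - 1 := by simp
    rw [this]; linarith [hre.2]
  have hγ : -1 < (lam - 1 / 2).re := by
    have : (lam - 1 / 2).re = lam.re - 1 / 2 := by simp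
    rw [this]; linarith [hre.1]
  rcases hs with rfl | rfl
  · obtain ⟨L, hL⟩ := exists_tendsto_euler_integral hβ hγ (-(((n : ℂ) - 1) / 2) - lam) hx
    simp only [one_mul]
    exact ⟨_, hL.const_mul _⟩
  · obtain ⟨L, hL⟩ := exists_tendsto_euler_integral_lower hβ hγ (-(((n : ℂ) - 1) / 2) - lam) hx
    simp only [neg_mul, one_mul, Left.neg_pos_iff]
    exact ⟨_, hL.const_mul _⟩

theorem one_lt_last_of_mem_cone {n : ℕ} (hn : 2 ≤ n) {y : Fin (n+1) → ℝ}
    (h1 : lformR n y y = 1) (h2 : lformR n (y - elast n) (y - elast n) < 0) :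
    1 < y (Fin.last n) := by
  have hl : Fin.last n ≠ 0 := by
    intro h; have := congrArg Fin.val h; simp at this; omega
  have : lformR n (y - elast n) (y - elast n) = lformR n y y - 2 * y (Fin.last n) + 1 := by
    have e : ∀ i, (if i = 0 then (-1 : ℝ) else 1) * (y - elast n) i * (y - elast n) i =
        (if i = 0 then (-1 : ℝ) else 1) * y i * y i +
        if i = Fin.last n then 1 - 2 * y (Fin.last n) else 0 := by
      intro i
      by_cases hi : i = Fin.last n
      · subst hi
        simp [elast, hl]
        ring
      · simp [elast, hi]
    simp only [lformR, e, Finset.sum_add_distrib]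
    simp
    ring
  rw [this, h1] at h2
  linarith

theorem lformC_zCurveBar {n : ℕ} (hn : 2 ≤ n) (t : ℝ) (y : Fin (n+1) → ℝ) :
    lformC n (zCurveBar n t) (fun i => (y i : ℂ)) =
      ((Real.sin t * y (Fin.last n) : ℝ) : ℂ) + ((Real.cos t * y 0 : ℝ) : ℂ) * Complex.I := by
  have hl : Fin.last n ≠ 0 := by
    intro h; have := congrArg Fin.val h; simp at this; omega
  have e : ∀ i, (if i = 0 then (-1 : ℂ) else 1) * zCurveBar n t i * (y i : ℂ) =
      (if i = 0 then ((Real.cos t * y 0 : ℝ) : ℂ) * Complex.I else 0) +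
      if i = Fin.last n then ((Real.sin t * y (Fin.last n) : ℝ) : ℂ) else 0 := by
    intro i
    by_cases h0 : i = 0
    · subst h0
      simp [zCurveBar, hl.symm]
      ring
    · by_cases hi : i = Fin.last n
      · subst hi
        simp [zCurveBar, hl]
      · simp [zCurveBar, hi, h0]
  simp only [lformC, e, Finset.sum_add_distrib]
  simp [add_comm]

end EulerBoundary

open Filter Topology in
theorem stmt17 (n : ℕ) (hn : 2 ≤ n) (lam : ℂ) (hlam : admissible n lam)
    (y : Fin (n+1) → ℝ) (hy : y ∈ futureCone n ∪ pastCone n)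
    (s : ℝ) (hs : s = if 0 < y 0 then 1 else -1) :
    (∀ t ∈ Set.Ioo (0 : ℝ) (Real.pi/2),
      (1 + lformC n (zCurveBar n t) (fun i => (y i : ℂ)))/2 ∉ slit) ∧
    ∃ L : ℂ,
      Tendsto (fun ε : ℝ => Flam n lam (((1 + y (Fin.last n))/2 : ℝ) + (s : ℂ) * (ε : ℂ) * Complex.I))
        (𝓝[>] (0 : ℝ)) (𝓝 L) ∧
      Tendsto (fun t : ℝ => Flam n lam ((1 + lformC n (zCurveBar n t) (fun i => (y i : ℂ)))/2))
        (𝓝[<] (Real.pi/2)) (𝓝 L) := by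
  have hcone : 1 < y (Fin.last n) ∧ y 0 ≠ 0 := by
    rcases hy with ⟨h1, h2, h3⟩ | ⟨h1, h2, h3⟩
    · exact ⟨one_lt_last_of_mem_cone hn h1 h2, h3.ne'⟩
    · exact ⟨one_lt_last_of_mem_cone hn h1 h2, h3.ne⟩
  obtain ⟨hyn, hy0⟩ := hcone
  have hs1 : s = 1 ∨ s = -1 := by rw [hs]; split_ifs <;> simp
  have hsy : 0 < s * y 0 := by
    rw [hs]
    split_ifs with h
    · simpa using h
    · have := lt_of_le_of_ne (not_lt.1 h) hy0
      linarith
  have him : ∀ t, ((1 + lformC n (zCurveBar n t) (fun i => (y i : ℂ))) / 2).im =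
      Real.cos t * y 0 / 2 := by
    intro t
    rw [lformC_zCurveBar hn, Complex.div_ofNat_im]
    simp [-Complex.ofReal_mul, -Complex.ofReal_cos, -Complex.ofReal_sin]
  have hcos : ∀ t ∈ Set.Ioo (0 : ℝ) (Real.pi/2), 0 < Real.cos t := fun t ht =>
    Real.cos_pos_of_mem_Ioo ⟨by linarith [ht.1, Real.pi_pos], ht.2⟩
  refine ⟨fun t ht hmem => ?_, ?_⟩
  · have h := hmem.1
    rw [him] at h
    have := mul_ne_zero (hcos t ht).ne' hy0
    exact this (by linarith)
  obtain ⟨L, hL⟩ := exists_tendsto_Flam hn hlam (x := (1 + y (Fin.last n)) / 2)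
    (by linarith) hs1
  refine ⟨L, hL.comp (tendsto_nhdsWithin_iff.2 ⟨?_, ?_⟩),
    hL.comp (tendsto_nhdsWithin_iff.2 ⟨?_, ?_⟩)⟩
  · refine Tendsto.mono_left ?_ nhdsWithin_le_nhds
    refine Continuous.tendsto' (by fun_prop) _ _ (by simp)
  · filter_upwards [self_mem_nhdsWithin] with ε hε
    have hε : 0 < ε := hε
    rcases hs1 with rfl | rfl <;> simpa [-Complex.ofReal_div, -Complex.ofReal_add] using hε
  · refine Tendsto.mono_left ?_ nhdsWithin_le_nhds
    simp only [lformC_zCurveBar hn]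
    refine Continuous.tendsto' (by fun_prop) _ _ (by simp)
  · filter_upwards [Ioo_mem_nhdsLT (show (0 : ℝ) < Real.pi / 2 by positivity)] with t ht
    rw [him]
    have := mul_pos (hcos t ht) hsy
    linarith
end

section
/- Let n ≥ 2, ρ = (n−1)/2, and let λ be either purely imaginary with nonnegative imaginary part or real with 0 < λ < ρ. For every smooth compactly supported function φ : ℝ × S^{n−1} → ℂ, the limit lim_{t→π/2⁻} ∫_ℝ ∫_{S^{n−1}} conj(φ(u,ω)) · F_λ((1 + [z_t, x(u,ω)])/2) · (cosh u)^{n−1} dσ(ω) du exists in ℂ, where x(u,ω) = (sinh u, (cosh u)·ω) parametrizes dS^n, σ is the rotation-invariant surface measure on the unit sphere S^{n−1} ⊂ ℝ^n, and (cosh u)^{n−1} du dσ(ω) is the G-invariant measure on dS^n. (This is the existence of the spherical distribution Ψ^λ as a distributional boundary value of the kernel Ψ_λ along the curve z_t.) -/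
open scoped BigOperators
open Filter Topology

/-- Integrating a power bound on the derivative. -/
lemma norm_sub_le_of_norm_deriv_le_rpow {E : Type*} [NormedAddCommGroup E] [NormedSpace ℝ E]
    {g g' : ℝ → E} {a b C r : ℝ} (hr : r ≠ 1)
    (hd : ∀ t ∈ Set.Ico a b, HasDerivAt g (g' t) t)
    (hb : ∀ t ∈ Set.Ico a b, ‖g' t‖ ≤ C * (b - t) ^ (-r)) {t : ℝ} (ht : t ∈ Set.Ico a b) :
    ‖g t - g a‖ ≤ C / (r - 1) * ((b - t) ^ (1 - r) - (b - a) ^ (1 - r)) := by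
  have hr' : r - 1 ≠ 0 := sub_ne_zero.2 hr
  have hsub : ∀ s ∈ Set.Icc a t, s ∈ Set.Ico a b := fun s hs => ⟨hs.1, hs.2.trans_lt ht.2⟩
  have hd' : ∀ s ∈ Set.Icc a t, HasDerivAt (fun x => g x - g a) (g' s) s := fun s hs =>
    (hd s (hsub s hs)).sub_const _
  have hB : ∀ s ∈ Set.Icc a t,
      HasDerivAt (fun x => C / (r - 1) * ((b - x) ^ (1 - r) - (b - a) ^ (1 - r)))
        (C * (b - s) ^ (-r)) s := by
    intro s hs
    have hpos : 0 < b - s := sub_pos.2 (hsub s hs).2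
    have h1 : HasDerivAt (fun x : ℝ => b - x) (-1) s := by
      simpa using (hasDerivAt_id s).const_sub b
    have h2 := ((h1.rpow_const (p := 1 - r) (Or.inl hpos.ne')).sub_const
      ((b - a) ^ (1 - r))).const_mul (C / (r - 1))
    refine h2.congr_deriv ?_
    rw [show 1 - r - 1 = -r by ring]
    field_simp
    ring
  refine image_norm_le_of_norm_deriv_right_le_deriv_boundary'
    (f := fun x => g x - g a) (f' := g')
    (B := fun x => C / (r - 1) * ((b - x) ^ (1 - r) - (b - a) ^ (1 - r)))
    (B' := fun s => C * (b - s) ^ (-r))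
    (fun s hs => (hd' s hs).continuousAt.continuousWithinAt)
    (fun s hs => (hd' s ⟨hs.1, hs.2.le⟩).hasDerivWithinAt) (by simp)
    (fun s hs => (hB s hs).continuousAt.continuousWithinAt)
    (fun s hs => (hB s ⟨hs.1, hs.2.le⟩).hasDerivWithinAt)
    (fun s hs => hb s (hsub s ⟨hs.1, hs.2.le⟩)) ⟨ht.1, le_rfl⟩

/-- If all derivatives of a function blow up at most like a fixed power at the right endpoint of an
interval, then the function has a limit there. -/
lemma exists_tendsto_of_deriv_power_bounds {E : Type*} [NormedAddCommGroup E] [NormedSpace ℝ E]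
    [CompleteSpace E] {f : ℕ → ℝ → E} {a b : ℝ} (hab : a < b)
    (hd : ∀ k, ∀ t ∈ Set.Ico a b, HasDerivAt (f k) (f (k + 1) t) t) (N : ℕ)
    (hb : ∀ k, ∃ C, ∀ t ∈ Set.Ico a b, ‖f k t‖ ≤ C * (b - t) ^ (-((N : ℝ) + 1 / 2))) :
    ∃ L, Tendsto (f 0) (𝓝[<] b) (𝓝 L) := by
  induction N with
  | succ N ih =>
    refine ih fun k => ?_
    obtain ⟨C, hC⟩ := hb (k + 1)
    set r : ℝ := ((N + 1 : ℕ) : ℝ) + 1 / 2 with hr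
    have hr1 : 1 < r := by rw [hr]; push_cast; linarith [(Nat.cast_nonneg N : (0 : ℝ) ≤ N)]
    have hab' : 0 < b - a := sub_pos.2 hab
    have hC0 : 0 ≤ C := by
      have := (norm_nonneg _).trans (hC a ⟨le_rfl, hab⟩)
      exact nonneg_of_mul_nonneg_left this (Real.rpow_pos_of_pos hab' _)
    refine ⟨C / (r - 1) + ‖f k a‖ / (b - a) ^ (1 - r), fun t ht => ?_⟩
    have h := norm_sub_le_of_norm_deriv_le_rpow hr1.ne' (hd k) hC ht
    have hpos : 0 < b - t := sub_pos.2 ht.2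
    have hpa : 0 < (b - a) ^ (1 - r) := Real.rpow_pos_of_pos hab' _
    have hmono : (b - a) ^ (1 - r) ≤ (b - t) ^ (1 - r) :=
      Real.rpow_le_rpow_of_nonpos hpos (by linarith [ht.1]) (by linarith)
    have hexp : -((N : ℝ) + 1 / 2) = 1 - r := by rw [hr]; push_cast; ring
    rw [hexp]
    have h1 : ‖f k t‖ ≤ ‖f k t - f k a‖ + ‖f k a‖ := by
      simpa using norm_add_le (f k t - f k a) (f k a)
    have h2 : ‖f k a‖ ≤ ‖f k a‖ / (b - a) ^ (1 - r) * (b - t) ^ (1 - r) := by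
      rw [div_mul_eq_mul_div, le_div_iff₀ hpa]
      gcongr
    have h3 : 0 ≤ C / (r - 1) * (b - a) ^ (1 - r) :=
      mul_nonneg (div_nonneg hC0 (by linarith)) hpa.le
    linarith
  | zero =>
    obtain ⟨C, hC⟩ := hb 2
    have hab' : 0 < b - a := sub_pos.2 hab
    have hC0 : 0 ≤ C := by
      have := (norm_nonneg _).trans (hC a ⟨le_rfl, hab⟩)
      exact nonneg_of_mul_nonneg_left this (Real.rpow_pos_of_pos hab' _)
    set M : ℝ := ‖f 1 a‖ + 2 * C * (b - a) ^ (1 / 2 : ℝ) with hM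
    have hbd : ∀ t ∈ Set.Ico a b, ‖f 1 t‖ ≤ M := by
      intro t ht
      have h := norm_sub_le_of_norm_deriv_le_rpow (r := 1 / 2) (by norm_num) (hd 1)
        (fun t ht => by simpa using hC t ht) ht
      have h1 : ‖f 1 t‖ ≤ ‖f 1 t - f 1 a‖ + ‖f 1 a‖ := by
        simpa using norm_add_le (f 1 t - f 1 a) (f 1 a)
      have h2 : 0 ≤ C * (b - t) ^ (1 - 1 / 2 : ℝ) :=
        mul_nonneg hC0 (Real.rpow_nonneg (sub_pos.2 ht.2).le _)
      rw [show (1 / 2 : ℝ) = 1 - 1 / 2 by norm_num] at hM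
      rw [show C / (1 / 2 - 1) = -2 * C by ring] at h
      linarith
    have hM0 : 0 ≤ M := (norm_nonneg _).trans (hbd a ⟨le_rfl, hab⟩)
    have hlip : LipschitzOnWith ⟨M, hM0⟩ (f 0) (Set.Ico a b) :=
      (convex_Ico a b).lipschitzOnWith_of_nnnorm_hasDerivWithin_le
        (fun t ht => (hd 0 t ht).hasDerivWithinAt) (fun t ht => hbd t ht)
    have hc : Cauchy (𝓝[Set.Ico a b] b) := by
      have : (𝓝[Set.Ico a b] b).NeBot := by
        rw [nhdsWithin_Ico_eq_nhdsLT hab]; infer_instance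
      exact cauchy_nhds.mono inf_le_left
    have := hc.map_of_le hlip.uniformContinuousOn (le_principal_iff.2 self_mem_nhdsWithin)
    rw [nhdsWithin_Ico_eq_nhdsLT hab] at this
    exact cauchy_map_iff_exists_tendsto.1 this

/-- Differentiation under an integral over a compact set. -/
lemma hasDerivAt_setIntegral_of_contDiffAt {P : Type*} [NormedAddCommGroup P] [NormedSpace ℝ P]
    [MeasurableSpace P] [BorelSpace P] {μ : MeasureTheory.Measure P}
    [MeasureTheory.IsFiniteMeasureOnCompacts μ] {K : Set P} (hK : IsCompact K) {I : Set ℝ}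
    (hI : IsOpen I) {H : ℝ × P → ℂ} (hH : ∀ t ∈ I, ∀ p ∈ K, ContDiffAt ℝ 1 H (t, p))
    {t₀ : ℝ} (ht₀ : t₀ ∈ I) :
    HasDerivAt (fun t => ∫ p in K, H (t, p) ∂μ) (∫ p in K, fderiv ℝ H (t₀, p) (1, 0) ∂μ) t₀ := by
  obtain ⟨ε, hε, hεI⟩ := Metric.nhds_basis_closedBall.mem_iff.1 (hI.mem_nhds ht₀)
  have hderiv : ∀ t ∈ I, ∀ p ∈ K, ContinuousAt (fun q => fderiv ℝ H q (1, 0)) (t, p) := by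
    intro t ht p hp
    exact ((hH t ht p hp).fderiv_right (m := 0) (by norm_num)).continuousAt.clm_apply
      continuousAt_const
  have hcomp : IsCompact (Metric.closedBall t₀ ε ×ˢ K) := (isCompact_closedBall _ _).prod hK
  obtain ⟨M, hM⟩ := hcomp.exists_bound_of_continuousOn (f := fun q => fderiv ℝ H q (1, 0))
    (fun q hq => (hderiv q.1 (hεI hq.1) q.2 hq.2).continuousWithinAt)
  have hcont : ∀ t ∈ I, ContinuousOn (fun p => H (t, p)) K := fun t ht p hp =>
    ((hH t ht p hp).continuousAt.comp (f := fun p => (t, p))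
      (by fun_prop)).continuousWithinAt
  have hcont' : ContinuousOn (fun p => fderiv ℝ H (t₀, p) (1, 0)) K := fun p hp =>
    (ContinuousAt.comp (f := fun p => (t₀, p)) (g := fun q => fderiv ℝ H q (1, 0))
      (hderiv t₀ ht₀ p hp) (by fun_prop)).continuousWithinAt
  have hKm := hK.measurableSet
  refine (hasDerivAt_integral_of_dominated_loc_of_deriv_le (μ := μ.restrict K)
    (F := fun t p => H (t, p)) (F' := fun t p => fderiv ℝ H (t, p) (1, 0))
    (s := Metric.closedBall t₀ ε) (bound := fun _ => M)
    (Metric.closedBall_mem_nhds t₀ hε) ?_ ?_ ?_ ?_ ?_ ?_).2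
  · filter_upwards [hI.mem_nhds ht₀] with t ht
    exact (hcont t ht).aestronglyMeasurable_of_isCompact hK hKm
  · exact (hcont t₀ ht₀).integrableOn_compact hK
  · exact hcont'.aestronglyMeasurable_of_isCompact hK hKm
  · filter_upwards [MeasureTheory.ae_restrict_mem hKm] with p hp t ht
    exact hM (t, p) ⟨ht, hp⟩
  · exact MeasureTheory.integrableOn_const hK.measure_lt_top.ne
  · filter_upwards [MeasureTheory.ae_restrict_mem hKm] with p hp t ht
    have h1 : HasDerivAt (fun s : ℝ => (s, p)) ((1 : ℝ), (0 : P)) t :=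
      (hasDerivAt_id t).prodMk (hasDerivAt_const t p)
    exact ((hH t (hεI ht) p hp).differentiableAt (by norm_num)).hasFDerivAt.comp_hasDerivAt t h1

section Sphere

variable {n : ℕ}

/-- The infinitesimal rotation `ω ↦ ωⱼ eₗ - ωₗ eⱼ`. -/
noncomputable def infinitesimalRotation (j l : Fin n) (ω : EuclideanSpace ℝ (Fin n)) :
    EuclideanSpace ℝ (Fin n) :=
  ω j • EuclideanSpace.single l (1 : ℝ) - ω l • EuclideanSpace.single j (1 : ℝ)

/-- The rotation by the angle `s` in the plane spanned by `eⱼ` and `eₗ`. -/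
noncomputable def planeRotation (j l : Fin n) (s : ℝ) (ω : EuclideanSpace ℝ (Fin n)) :
    EuclideanSpace ℝ (Fin n) :=
  ω + ((Real.cos s - 1) * ω j - Real.sin s * ω l) • EuclideanSpace.single j (1 : ℝ) +
    (Real.sin s * ω j + (Real.cos s - 1) * ω l) • EuclideanSpace.single l (1 : ℝ)

lemma norm_planeRotation {j l : Fin n} (hjl : j ≠ l) (s : ℝ) (ω : EuclideanSpace ℝ (Fin n)) :
    ‖planeRotation j l s ω‖ = ‖ω‖ := by
  rw [← sq_eq_sq₀ (norm_nonneg _) (norm_nonneg _), ← real_inner_self_eq_norm_sq,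
    ← real_inner_self_eq_norm_sq, planeRotation]
  simp only [inner_add_left, inner_add_right, real_inner_smul_left, real_inner_smul_right,
    EuclideanSpace.inner_single_left, EuclideanSpace.inner_single_right]
  simp [hjl, hjl.symm]
  linear_combination (ω.ofLp j ^ 2 + ω.ofLp l ^ 2) * Real.sin_sq_add_cos_sq s

/-- The rotation by the angle `s` in the plane spanned by `eⱼ` and `eₗ`, as an isometry. -/
noncomputable def planeRotationEquiv {j l : Fin n} (hjl : j ≠ l) (s : ℝ) :
    EuclideanSpace ℝ (Fin n) ≃ₗᵢ[ℝ] EuclideanSpace ℝ (Fin n) :=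
  LinearIsometry.toLinearIsometryEquiv
    { toFun := planeRotation j l s
      map_add' := fun x y => by
        ext i; simp [planeRotation]; split_ifs <;> ring
      map_smul' := fun c x => by
        ext i; simp [planeRotation]; split_ifs <;> ring
      norm_map' := norm_planeRotation hjl s } rfl

lemma contDiff_planeRotation (j l : Fin n) :
    ContDiff ℝ 1 (fun q : ℝ × EuclideanSpace ℝ (Fin n) => planeRotation j l q.1 q.2) := by
  unfold planeRotation
  have h1 : ContDiff ℝ 1 (fun q : ℝ × EuclideanSpace ℝ (Fin n) => Real.cos q.1) :=
    Real.contDiff_cos.comp contDiff_fst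
  have h2 : ContDiff ℝ 1 (fun q : ℝ × EuclideanSpace ℝ (Fin n) => Real.sin q.1) :=
    Real.contDiff_sin.comp contDiff_fst
  fun_prop

lemma hasDerivAt_planeRotation (j l : Fin n) (ω : EuclideanSpace ℝ (Fin n)) :
    HasDerivAt (fun s => planeRotation j l s ω) (infinitesimalRotation j l ω) 0 := by
  have h1 := ((((Real.hasDerivAt_cos 0).sub_const 1).mul_const (ω j)).sub
    ((Real.hasDerivAt_sin 0).mul_const (ω l))).smul_const (EuclideanSpace.single j (1 : ℝ))
  have h2 := (((Real.hasDerivAt_sin 0).mul_const (ω j)).add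
    (((Real.hasDerivAt_cos 0).sub_const 1).mul_const (ω l))).smul_const
      (EuclideanSpace.single l (1 : ℝ))
  refine ((h1.const_add ω).add h2).congr_deriv ?_
  ext i
  simp [infinitesimalRotation]
  ring

variable {σ : MeasureTheory.Measure (EuclideanSpace ℝ (Fin n))} [MeasureTheory.IsFiniteMeasure σ]

/-- Infinitesimal invariance of a rotation-invariant measure on the sphere. -/
lemma integral_fderiv_infinitesimalRotation
    (hinv : ∀ f : EuclideanSpace ℝ (Fin n) ≃ₗᵢ[ℝ] EuclideanSpace ℝ (Fin n), σ.map f = σ)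
    {h : EuclideanSpace ℝ (Fin n) → ℂ}
    (hh : ∀ ω ∈ Metric.sphere (0 : EuclideanSpace ℝ (Fin n)) 1, ContDiffAt ℝ 1 h ω)
    {j l : Fin n} (hjl : j ≠ l) :
    ∫ ω in Metric.sphere (0 : EuclideanSpace ℝ (Fin n)) 1,
      fderiv ℝ h ω (infinitesimalRotation j l ω) ∂σ = 0 := by
  set S := Metric.sphere (0 : EuclideanSpace ℝ (Fin n)) 1 with hS
  have hrot : ∀ s, ∀ ω ∈ S, planeRotation j l s ω ∈ S := fun s ω hω => by
    rw [hS, mem_sphere_zero_iff_norm] at hω ⊢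
    rw [norm_planeRotation hjl, hω]
  have hzero : ∀ ω, planeRotation j l 0 ω = ω := fun ω => by simp [planeRotation]
  have hH : ∀ s ∈ (Set.univ : Set ℝ), ∀ ω ∈ S, ContDiffAt ℝ 1
      (fun q : ℝ × EuclideanSpace ℝ (Fin n) => h (planeRotation j l q.1 q.2)) (s, ω) :=
    fun s _ ω hω => (hh _ (hrot s ω hω)).comp (s, ω) (contDiff_planeRotation j l).contDiffAt
  have h1 := hasDerivAt_setIntegral_of_contDiffAt (μ := σ) (isCompact_sphere 0 1) isOpen_univ hH
    (Set.mem_univ 0)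
  have hconst : ∀ s, ∫ ω in S, h (planeRotation j l s ω) ∂σ = ∫ ω in S, h ω ∂σ := by
    intro s
    have hpre : (planeRotationEquiv hjl s) ⁻¹' S = S := by
      ext ω
      simp [hS]
    have hmp : MeasureTheory.MeasurePreserving (planeRotationEquiv hjl s) σ σ :=
      ⟨(planeRotationEquiv hjl s).continuous.measurable, hinv _⟩
    have := hmp.setIntegral_preimage_emb
      (planeRotationEquiv hjl s).toHomeomorph.measurableEmbedding h S
    rw [hpre] at this
    exact this
  have h2 := h1.unique ((hasDerivAt_const (0 : ℝ) (∫ ω in S, h ω ∂σ)).congr_of_eventuallyEq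
    (Eventually.of_forall hconst))
  rw [← h2]
  refine MeasureTheory.setIntegral_congr_fun (isCompact_sphere 0 1).measurableSet fun ω hω => ?_
  have h3 : HasDerivAt (fun s : ℝ => (s, ω)) ((1 : ℝ), (0 : EuclideanSpace ℝ (Fin n))) 0 :=
    (hasDerivAt_id 0).prodMk (hasDerivAt_const 0 ω)
  have h4 := ((hH 0 trivial ω hω).differentiableAt (by norm_num)).hasFDerivAt.comp_hasDerivAt 0 h3
  have h5 : HasFDerivAt h (fderiv ℝ h ω) (planeRotation j l 0 ω) := by
    rw [hzero]
    exact ((hh ω hω).differentiableAt (by norm_num)).hasFDerivAt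
  exact (h5.comp_hasDerivAt 0 (hasDerivAt_planeRotation j l ω)).unique h4

/-- The divergence theorem on the sphere for the tangential projection of `eₗ`. -/
lemma integral_fderiv_tangential
    (hinv : ∀ f : EuclideanSpace ℝ (Fin n) ≃ₗᵢ[ℝ] EuclideanSpace ℝ (Fin n), σ.map f = σ)
    {g : EuclideanSpace ℝ (Fin n) → ℂ}
    (hg : ∀ ω ∈ Metric.sphere (0 : EuclideanSpace ℝ (Fin n)) 1, ContDiffAt ℝ 1 g ω) (l : Fin n) :
    ∫ ω in Metric.sphere (0 : EuclideanSpace ℝ (Fin n)) 1,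
      (fderiv ℝ g ω (EuclideanSpace.single l (1 : ℝ) - ω l • ω) -
        ((n : ℂ) - 1) * ((ω l : ℝ) : ℂ) * g ω) ∂σ = 0 := by
  set S := Metric.sphere (0 : EuclideanSpace ℝ (Fin n)) 1 with hS
  have hcoord : ∀ j : Fin n, ContDiff ℝ 1 (fun ω : EuclideanSpace ℝ (Fin n) => ((ω j : ℝ) : ℂ)) :=
    fun j => Complex.ofRealCLM.contDiff.comp (by fun_prop)
  have hprod : ∀ j, ∀ ω ∈ S, ContDiffAt ℝ 1 (fun ω => ((ω j : ℝ) : ℂ) * g ω) ω :=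
    fun j ω hω => (hcoord j).contDiffAt.mul (hg ω hω)
  have hfd : ∀ j, ∀ ω ∈ S, fderiv ℝ (fun ω => ((ω j : ℝ) : ℂ) * g ω) ω
      (infinitesimalRotation j l ω) =
      ((ω j : ℝ) : ℂ) * fderiv ℝ g ω (infinitesimalRotation j l ω) +
        ((infinitesimalRotation j l ω j : ℝ) : ℂ) * g ω := by
    intro j ω hω
    have h1 : HasFDerivAt (fun ω : EuclideanSpace ℝ (Fin n) => ((ω j : ℝ) : ℂ))
        (Complex.ofRealCLM.comp (EuclideanSpace.proj j)) ω :=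
      (Complex.ofRealCLM.comp (EuclideanSpace.proj j : EuclideanSpace ℝ (Fin n) →L[ℝ] ℝ)).hasFDerivAt
    have h2 := h1.fun_mul ((hg ω hω).differentiableAt (by norm_num)).hasFDerivAt
    rw [h2.fderiv]
    simp [mul_comm]
  have hsum : ∀ ω ∈ S, ∑ j ∈ Finset.univ.erase l,
      fderiv ℝ (fun ω => ((ω j : ℝ) : ℂ) * g ω) ω (infinitesimalRotation j l ω) =
      fderiv ℝ g ω (EuclideanSpace.single l (1 : ℝ) - ω l • ω) -
        ((n : ℂ) - 1) * ((ω l : ℝ) : ℂ) * g ω := by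
    intro ω hω
    have hvec : ∑ j ∈ Finset.univ.erase l, ω j • infinitesimalRotation j l ω =
        EuclideanSpace.single l (1 : ℝ) - ω l • ω := by
      have hall : ∑ j, ω j • infinitesimalRotation j l ω =
          EuclideanSpace.single l (1 : ℝ) - ω l • ω := by
        have hn : ∑ j, ω j ^ 2 = 1 := by
          have := EuclideanSpace.real_norm_sq_eq ω
          rw [mem_sphere_zero_iff_norm.1 hω] at this
          simpa using this.symm
        have hb : ∑ j, ω j • EuclideanSpace.single j (1 : ℝ) = ω := by
          ext i
          simp [Finset.sum_apply, Pi.single_apply]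
        calc ∑ j, ω j • infinitesimalRotation j l ω
            = ∑ j, ((ω j ^ 2) • EuclideanSpace.single l (1 : ℝ) -
                ω l • (ω j • EuclideanSpace.single j (1 : ℝ))) := by
              refine Finset.sum_congr rfl fun j _ => ?_
              rw [infinitesimalRotation, smul_sub, smul_smul, smul_comm, pow_two]
          _ = _ := by rw [Finset.sum_sub_distrib, ← Finset.sum_smul, hn, ← Finset.smul_sum, hb,
                one_smul]
      rw [← hall, ← Finset.add_sum_erase _ _ (Finset.mem_univ l)]
      simp [infinitesimalRotation]
    rw [Finset.sum_congr rfl fun j _ => hfd j ω hω, Finset.sum_add_distrib, ← hvec, map_sum,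
      ← Finset.sum_mul, sub_eq_add_neg]
    congr 1
    · refine Finset.sum_congr rfl fun j _ => ?_
      rw [map_smul, Complex.real_smul]
    · have : ∀ j ∈ Finset.univ.erase l,
          ((infinitesimalRotation j l ω j : ℝ) : ℂ) = -((ω l : ℝ) : ℂ) := by
        intro j hj
        simp [infinitesimalRotation, Finset.ne_of_mem_erase hj]
      rw [Finset.sum_congr rfl this, Finset.sum_const, Finset.card_erase_of_mem (Finset.mem_univ l),
        Finset.card_univ, Fintype.card_fin, nsmul_eq_mul, Nat.cast_sub l.pos]
      push_cast
      ring
  have hmeas : MeasurableSet S := (isCompact_sphere 0 1).measurableSet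
  rw [← MeasureTheory.setIntegral_congr_fun hmeas hsum, MeasureTheory.integral_finsetSum]
  · exact Finset.sum_eq_zero fun j hj =>
      integral_fderiv_infinitesimalRotation hinv (hprod j) (Finset.ne_of_mem_erase hj)
  · intro j _
    refine ContinuousOn.integrableOn_compact (isCompact_sphere 0 1) fun ω hω => ?_
    refine (((hprod j ω hω).fderiv_right (m := 0) (by norm_num)).continuousAt.clm_apply
      ?_).continuousWithinAt
    unfold infinitesimalRotation
    fun_prop

end Sphere

lemma one_sub_mul_mem_slitPlane {z : ℂ} (hz : z ∈ slitᶜ) {t : ℝ} (ht : t ∈ Set.Icc (0 : ℝ) 1) :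
    1 - z * t ∈ Complex.slitPlane := by
  rw [Complex.mem_slitPlane_iff]
  by_contra! h
  simp only [Complex.sub_re, Complex.one_re, Complex.mul_re, Complex.ofReal_re, Complex.ofReal_im,
    mul_zero, sub_zero, Complex.sub_im, Complex.one_im, Complex.mul_im, zero_add] at h
  have ht0 : 0 < t := ht.1.lt_of_ne fun h0 => by
    rw [← h0] at h; norm_num at h
  have him : z.im = 0 := by
    have : z.im * t = 0 := by linarith [h.2]
    exact (mul_eq_zero.1 this).resolve_right ht0.ne'
  refine hz ⟨him, ?_⟩
  nlinarith [h.1, ht.2]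

lemma isOpen_compl_slit : IsOpen slitᶜ := by
  have : slit = {z : ℂ | z.im = 0} ∩ {z | 1 ≤ z.re} := rfl
  rw [this]
  exact ((isClosed_eq Complex.continuous_im continuous_const).inter
    (isClosed_le continuous_const Complex.continuous_re)).isOpen_compl

lemma continuousAt_one_sub_mul_cpow {z : ℂ} (hz : z ∈ slitᶜ) {t : ℝ}
    (ht : t ∈ Set.Icc (0 : ℝ) 1) (c : ℂ) :
    ContinuousAt (fun q : ℂ × ℝ => (1 - q.1 * (q.2 : ℂ)) ^ c) (z, t) := by
  have h : ContinuousAt (fun q : ℂ × ℝ => 1 - q.1 * (q.2 : ℂ)) (z, t) := by fun_prop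
  exact h.cpow continuousAt_const (one_sub_mul_mem_slitPlane hz ht)

/-- Euler type integrals are holomorphic off the cut. -/
lemma differentiableOn_euler_integral {w : ℝ → ℂ}
    (hw : IntervalIntegrable w MeasureTheory.volume 0 1) (c : ℂ) :
    DifferentiableOn ℂ (fun z => ∫ t in (0 : ℝ)..1, w t * (1 - z * (t : ℂ)) ^ c) slitᶜ := by
  intro z₀ hz₀
  obtain ⟨ε, hε, hball⟩ := Metric.nhds_basis_closedBall.mem_iff.1 (isOpen_compl_slit.mem_nhds hz₀)
  have hIoc : Set.uIoc (0 : ℝ) 1 ⊆ Set.Icc 0 1 := by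
    rw [Set.uIoc_of_le zero_le_one]; exact Set.Ioc_subset_Icc_self
  set d : ℂ × ℝ → ℂ := fun q => c * (1 - q.1 * (q.2 : ℂ)) ^ (c - 1) * (-(q.2 : ℂ)) with hd
  have hdc : ∀ z ∈ slitᶜ, ∀ t ∈ Set.Icc (0 : ℝ) 1, ContinuousAt d (z, t) := by
    intro z hz t ht
    have := continuousAt_one_sub_mul_cpow hz ht (c - 1)
    have h2 : ContinuousAt (fun q : ℂ × ℝ => -(q.2 : ℂ)) (z, t) := by fun_prop
    exact (continuousAt_const.mul this).mul h2
  obtain ⟨M, hM⟩ := ((isCompact_closedBall z₀ ε).prod isCompact_Icc).exists_bound_of_continuousOn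
    (f := d) fun q hq => (hdc q.1 (hball hq.1) q.2 hq.2).continuousWithinAt
  have hker : ∀ z ∈ slitᶜ, ContinuousOn (fun t : ℝ => (1 - z * (t : ℂ)) ^ c) (Set.uIcc 0 1) := by
    intro z hz t ht
    rw [Set.uIcc_of_le zero_le_one] at ht
    exact (ContinuousAt.comp (f := fun t : ℝ => (z, t)) (continuousAt_one_sub_mul_cpow hz ht c)
      (by fun_prop)).continuousWithinAt
  have hint : ∀ z ∈ slitᶜ,
      IntervalIntegrable (fun t => w t * (1 - z * (t : ℂ)) ^ c) MeasureTheory.volume 0 1 :=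
    fun z hz => hw.mul_continuousOn (hker z hz)
  have hd0 : ContinuousOn (fun t : ℝ => d (z₀, t)) (Set.uIcc 0 1) := by
    intro t ht
    rw [Set.uIcc_of_le zero_le_one] at ht
    exact (ContinuousAt.comp (f := fun t : ℝ => (z₀, t)) (hdc z₀ hz₀ t ht)
      (by fun_prop)).continuousWithinAt
  have key := intervalIntegral.hasDerivAt_integral_of_dominated_loc_of_deriv_le
    (μ := MeasureTheory.volume) (a := (0 : ℝ)) (b := 1) (x₀ := z₀)
    (F := fun z t => w t * (1 - z * (t : ℂ)) ^ c) (F' := fun z t => w t * d (z, t))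
    (s := Metric.closedBall z₀ ε) (bound := fun t => ‖w t‖ * M)
    (Metric.closedBall_mem_nhds z₀ hε) ?_ (hint z₀ hz₀)
    (intervalIntegrable_iff.1 (hw.mul_continuousOn hd0)).aestronglyMeasurable
    ?_ (hw.norm.mul_const M) ?_
  · exact key.2.differentiableAt.differentiableWithinAt
  · filter_upwards [isOpen_compl_slit.mem_nhds hz₀] with z hz
    exact (intervalIntegrable_iff.1 (hint z hz)).aestronglyMeasurable
  · refine Eventually.of_forall fun t ht z hz => ?_
    rw [norm_mul]
    exact mul_le_mul_of_nonneg_left (hM (z, t) ⟨hz, hIoc ht⟩) (norm_nonneg _)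
  · refine Eventually.of_forall fun t ht z hz => ?_
    have h1 : HasDerivAt (fun z : ℂ => 1 - z * (t : ℂ)) (-(t : ℂ)) z := by
      simpa using ((hasDerivAt_id z).mul_const (t : ℂ)).const_sub 1
    exact (h1.cpow_const (one_sub_mul_mem_slitPlane (hball hz) (hIoc ht))).const_mul (w t)

/-- A bound for Euler type integrals by the distance of the segment `[0, z]` from the branch
point. -/
lemma norm_euler_integral_le {w : ℝ → ℂ} (hw : IntervalIntegrable w MeasureTheory.volume 0 1)
    {c : ℂ} (hc : c.re ≤ 0) {z : ℂ} {δ : ℝ} (hδ : 0 < δ)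
    (hz : ∀ t ∈ Set.Icc (0 : ℝ) 1, δ ≤ ‖1 - z * (t : ℂ)‖) :
    ‖∫ t in (0 : ℝ)..1, w t * (1 - z * (t : ℂ)) ^ c‖ ≤
      (∫ t in (0 : ℝ)..1, ‖w t‖) * Real.exp (Real.pi * |c.im|) * δ ^ c.re := by
  rw [mul_assoc, ← intervalIntegral.integral_mul_const]
  refine intervalIntegral.norm_integral_le_of_norm_le zero_le_one
    (Eventually.of_forall fun t ht => ?_) (hw.norm.mul_const _)
  have hδt := hz t ⟨ht.1.le, ht.2⟩
  rw [norm_mul]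
  refine mul_le_mul_of_nonneg_left ?_ (norm_nonneg _)
  refine (Complex.norm_cpow_le _ _).trans ?_
  rw [div_eq_inv_mul, ← Real.exp_neg]
  refine mul_le_mul (Real.exp_le_exp.2 ?_) (Real.rpow_le_rpow_of_nonpos hδ hδt hc)
    (Real.rpow_nonneg (norm_nonneg _) _) (Real.exp_pos _).le
  refine (neg_le_abs _).trans ?_
  rw [abs_mul]
  exact mul_le_mul_of_nonneg_right (Complex.abs_arg_le_pi _) (abs_nonneg _)

section Euler

variable {n : ℕ} {lam : ℂ}

lemma intervalIntegrable_euler_weight (h1 : lam.re < ((n : ℝ) - 1) / 2) (h2 : 0 ≤ lam.re) :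
    IntervalIntegrable (fun t : ℝ => (t : ℂ) ^ (((n : ℂ) - 1)/2 - lam - 1) *
      ((1 : ℂ) - (t : ℂ)) ^ (lam - 1/2)) MeasureTheory.volume 0 1 := by
  have hre : (((n : ℂ) - 1) / 2).re = ((n : ℝ) - 1) / 2 := by
    rw [show ((n : ℂ) - 1) / 2 = ((((n : ℝ) - 1) / 2 : ℝ) : ℂ) by push_cast; ring,
      Complex.ofReal_re]
  have := Complex.betaIntegral_convergent (u := ((n : ℂ) - 1)/2 - lam) (v := lam + 1/2)
    (by rw [Complex.sub_re, hre]; linarith)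
    (by
      rw [Complex.add_re, show (1 / 2 : ℂ) = ((1 / 2 : ℝ) : ℂ) by push_cast; ring,
        Complex.ofReal_re]
      linarith)
  rwa [show lam + 1/2 - 1 = lam - 1/2 by ring] at this

lemma differentiableOn_Flam (h1 : lam.re < ((n : ℝ) - 1) / 2) (h2 : 0 ≤ lam.re) :
    DifferentiableOn ℂ (Flam n lam) slitᶜ :=
  (differentiableOn_euler_integral (intervalIntegrable_euler_weight h1 h2) _).const_mul _

lemma exists_norm_Flam_le (h1 : lam.re < ((n : ℝ) - 1) / 2) (h2 : 0 ≤ lam.re) :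
    ∃ C r : ℝ, 0 ≤ C ∧ ∀ z : ℂ, ∀ δ : ℝ, 0 < δ →
      (∀ t ∈ Set.Icc (0 : ℝ) 1, δ ≤ ‖1 - z * (t : ℂ)‖) → ‖Flam n lam z‖ ≤ C * δ ^ (-r) := by
  set c : ℂ := -(((n : ℂ) - 1)/2) - lam with hc
  have hcre : c.re = -(((n : ℝ) - 1) / 2 + lam.re) := by
    rw [hc, show ((n : ℂ) - 1) / 2 = ((((n : ℝ) - 1) / 2 : ℝ) : ℂ) by push_cast; ring,
      Complex.sub_re, Complex.neg_re, Complex.ofReal_re]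
    ring
  have hw := intervalIntegrable_euler_weight h1 h2
  refine ⟨‖Complex.Gamma ((n : ℂ)/2) /
      (Complex.Gamma (((n : ℂ) - 1)/2 - lam) * Complex.Gamma (1/2 + lam))‖ *
      ((∫ t in (0 : ℝ)..1, ‖(t : ℂ) ^ (((n : ℂ) - 1)/2 - lam - 1) *
        ((1 : ℂ) - (t : ℂ)) ^ (lam - 1/2)‖) * Real.exp (Real.pi * |c.im|)),
    ((n : ℝ) - 1) / 2 + lam.re, mul_nonneg (norm_nonneg _)
    (mul_nonneg (intervalIntegral.integral_nonneg zero_le_one fun t _ => norm_nonneg _)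
      (Real.exp_pos _).le), fun z δ hδ hz => ?_⟩
  rw [Flam, norm_mul, mul_assoc]
  refine mul_le_mul_of_nonneg_left ?_ (norm_nonneg _)
  rw [← hcre]
  exact norm_euler_integral_le hw (by rw [hcre]; linarith) hδ hz

end Euler

section DeSitter

variable {n : ℕ}

/-- The boost vector field on de Sitter space in the coordinates `(sinh u, cosh u · ω)`. -/
noncomputable def boostField (l : Fin n) (p : ℝ × EuclideanSpace ℝ (Fin n)) :
    ℝ × EuclideanSpace ℝ (Fin n) :=
  (p.2 l, (Real.sinh p.1 / Real.cosh p.1) • (EuclideanSpace.single l (1 : ℝ) - p.2 l • p.2))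

lemma contDiff_boostField (l : Fin n) : ContDiff ℝ (⊤ : ℕ∞) (boostField l) := by
  have h : ContDiff ℝ (⊤ : ℕ∞)
      (fun p : ℝ × EuclideanSpace ℝ (Fin n) => Real.sinh p.1 / Real.cosh p.1) :=
    (Real.contDiff_sinh.comp contDiff_fst).div (Real.contDiff_cosh.comp contDiff_fst)
      fun p => (Real.cosh_pos _).ne'
  unfold boostField
  fun_prop

variable {σ : MeasureTheory.Measure (EuclideanSpace ℝ (Fin n))} [MeasureTheory.IsFiniteMeasure σ]

/-- The boost vector field is divergence free. -/
lemma integral_fderiv_boostField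
    (hinv : ∀ f : EuclideanSpace ℝ (Fin n) ≃ₗᵢ[ℝ] EuclideanSpace ℝ (Fin n), σ.map f = σ)
    {G : ℝ × EuclideanSpace ℝ (Fin n) → ℂ}
    (hG : ∀ u, ∀ ω ∈ Metric.sphere (0 : EuclideanSpace ℝ (Fin n)) 1, ContDiffAt ℝ 1 G (u, ω))
    {R : ℝ} (hR : 0 ≤ R) (hG0 : ∀ ω, G (R, ω) = 0 ∧ G (-R, ω) = 0) (l : Fin n) :
    ∫ p in Set.Icc (-R) R ×ˢ Metric.sphere (0 : EuclideanSpace ℝ (Fin n)) 1,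
      ((Real.cosh p.1 : ℝ) : ℂ) ^ (n - 1) * fderiv ℝ G p (boostField l p)
        ∂(MeasureTheory.volume.prod σ) = 0 := by
  set S := Metric.sphere (0 : EuclideanSpace ℝ (Fin n)) 1 with hS
  have hSc : IsCompact S := isCompact_sphere 0 1
  have hK : IsCompact (Set.Icc (-R) R ×ˢ S) := isCompact_Icc.prod hSc
  set w : ℝ → ℂ := fun u => ((Real.cosh u : ℝ) : ℂ) ^ (n - 1) with hw
  set th : ℝ → ℂ := fun u => ((Real.sinh u / Real.cosh u : ℝ) : ℂ) with hth
  have hwc : Continuous w := by fun_prop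
  have hthc : Continuous th := Complex.continuous_ofReal.comp
    (Real.continuous_sinh.div Real.continuous_cosh fun u => (Real.cosh_pos u).ne')
  have hwd : ∀ u, HasDerivAt w (((n : ℂ) - 1) * th u * w u) u := by
    intro u
    have h := ((Real.hasDerivAt_cosh u).ofReal_comp).pow (n - 1)
    refine h.congr_deriv ?_
    have hn : ((n - 1 : ℕ) : ℂ) = (n : ℂ) - 1 := by rw [Nat.cast_sub l.pos]; simp
    have hc : ((Real.cosh u : ℝ) : ℂ) ≠ 0 := Complex.ofReal_ne_zero.2 (Real.cosh_pos u).ne'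
    rw [hn, hw, hth]
    rcases Nat.eq_zero_or_pos (n - 1) with h0 | h0
    · rw [← hn, h0]; simp
    · obtain ⟨m, hm⟩ := Nat.exists_eq_succ_of_ne_zero h0.ne'
      simp only [hm, Nat.succ_eq_add_one, Nat.add_sub_cancel, Complex.ofReal_div, pow_succ]
      field_simp
  have hGd : ∀ u, ∀ ω ∈ S, HasFDerivAt G (fderiv ℝ G (u, ω)) (u, ω) := fun u ω hω =>
    ((hG u ω hω).differentiableAt (by norm_num)).hasFDerivAt
  have hGc : ∀ u, ∀ ω ∈ S, ContinuousAt (fderiv ℝ G) (u, ω) := fun u ω hω =>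
    ((hG u ω hω).fderiv_right (m := 0) (by norm_num)).continuousAt
  set A : ℝ × EuclideanSpace ℝ (Fin n) → ℂ := fun p => ((p.2 l : ℝ) : ℂ) *
    (((n : ℂ) - 1) * th p.1 * w p.1 * G p + w p.1 * fderiv ℝ G p (1, 0)) with hA
  set B : ℝ × EuclideanSpace ℝ (Fin n) → ℂ := fun p => (th p.1 * w p.1) *
    (fderiv ℝ G p (0, EuclideanSpace.single l (1 : ℝ) - p.2 l • p.2) -
      ((n : ℂ) - 1) * ((p.2 l : ℝ) : ℂ) * G p) with hB
  have hAc : ∀ u, ∀ ω ∈ S, ContinuousAt A (u, ω) := by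
    intro u ω hω
    have h1 := (hGc u ω hω).clm_apply
      (continuousAt_const (y := ((1 : ℝ), (0 : EuclideanSpace ℝ (Fin n)))))
    have h2 := (hG u ω hω).continuousAt
    have h3 : Continuous fun p : ℝ × EuclideanSpace ℝ (Fin n) => th p.1 := by fun_prop
    have h4 : Continuous fun p : ℝ × EuclideanSpace ℝ (Fin n) => w p.1 :=
      hwc.comp continuous_fst
    have h5 : Continuous fun p : ℝ × EuclideanSpace ℝ (Fin n) => ((p.2 l : ℝ) : ℂ) := by fun_prop
    exact h5.continuousAt.mul ((((continuousAt_const.mul h3.continuousAt).mul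
      h4.continuousAt).mul h2).add (h4.continuousAt.mul h1))
  have hBc : ∀ u, ∀ ω ∈ S, ContinuousAt B (u, ω) := by
    intro u ω hω
    have h0 : Continuous fun p : ℝ × EuclideanSpace ℝ (Fin n) =>
      ((0 : ℝ), EuclideanSpace.single l (1 : ℝ) - p.2 l • p.2) := by fun_prop
    have h1 := (hGc u ω hω).clm_apply h0.continuousAt
    have h2 := (hG u ω hω).continuousAt
    have h3 : Continuous fun p : ℝ × EuclideanSpace ℝ (Fin n) => th p.1 := by fun_prop
    have h4 : Continuous fun p : ℝ × EuclideanSpace ℝ (Fin n) => w p.1 :=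
      hwc.comp continuous_fst
    have h5 : Continuous fun p : ℝ × EuclideanSpace ℝ (Fin n) => ((p.2 l : ℝ) : ℂ) := by fun_prop
    exact (h3.continuousAt.mul h4.continuousAt).mul
      (h1.sub ((continuousAt_const.mul h5.continuousAt).mul h2))
  have hAi : MeasureTheory.IntegrableOn A (Set.Icc (-R) R ×ˢ S) (MeasureTheory.volume.prod σ) :=
    ContinuousOn.integrableOn_compact hK fun p hp => (hAc p.1 p.2 hp.2).continuousWithinAt
  have hBi : MeasureTheory.IntegrableOn B (Set.Icc (-R) R ×ˢ S) (MeasureTheory.volume.prod σ) :=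
    ContinuousOn.integrableOn_compact hK fun p hp => (hBc p.1 p.2 hp.2).continuousWithinAt
  have hA0 : ∫ p in Set.Icc (-R) R ×ˢ S, A p ∂(MeasureTheory.volume.prod σ) = 0 := by
    rw [← MeasureTheory.setIntegral_prod_swap, MeasureTheory.setIntegral_prod (fun z => A z.swap) hAi.swap]
    refine MeasureTheory.setIntegral_eq_zero_of_forall_eq_zero fun ω hω => ?_
    rw [MeasureTheory.integral_Icc_eq_integral_Ioc, ← intervalIntegral.integral_of_le (by linarith)]
    simp only [hA, Prod.swap_prod_mk]
    rw [intervalIntegral.integral_const_mul]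
    have hder : ∀ u ∈ Set.uIcc (-R) R, HasDerivAt (fun u => w u * G (u, ω))
        (((n : ℂ) - 1) * th u * w u * G (u, ω) + w u * fderiv ℝ G (u, ω) (1, 0)) u := by
      intro u _
      have h3 : HasDerivAt (fun s : ℝ => (s, ω)) ((1 : ℝ), (0 : EuclideanSpace ℝ (Fin n))) u :=
        (hasDerivAt_id u).prodMk (hasDerivAt_const u ω)
      exact (hwd u).mul ((hGd u ω hω).comp_hasDerivAt u h3)
    rw [intervalIntegral.integral_eq_sub_of_hasDerivAt hder, (hG0 ω).1, (hG0 ω).2]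
    · simp
    · refine ContinuousOn.intervalIntegrable fun u _ => ?_
      have hp : ContinuousAt (fun u : ℝ => (u, ω)) u := by fun_prop
      have h1 := ContinuousAt.comp (f := fun u : ℝ => (u, ω))
        ((hGc u ω hω).clm_apply
          (continuousAt_const (y := ((1 : ℝ), (0 : EuclideanSpace ℝ (Fin n)))))) hp
      have h2 := ContinuousAt.comp (f := fun u : ℝ => (u, ω)) (hG u ω hω).continuousAt hp
      exact ((((continuousAt_const.mul hthc.continuousAt).mul hwc.continuousAt).mul h2).add
        (hwc.continuousAt.mul h1)).continuousWithinAt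
  have hB0 : ∫ p in Set.Icc (-R) R ×ˢ S, B p ∂(MeasureTheory.volume.prod σ) = 0 := by
    rw [MeasureTheory.setIntegral_prod _ hBi]
    refine MeasureTheory.setIntegral_eq_zero_of_forall_eq_zero fun u _ => ?_
    simp only [hB]
    rw [MeasureTheory.integral_const_mul]
    have hslice : ∀ ω ∈ S, ContDiffAt ℝ 1 (fun ω => G (u, ω)) ω := fun ω hω =>
      (hG u ω hω).comp ω (contDiffAt_const.prodMk contDiffAt_id)
    refine mul_eq_zero_of_right _ ?_
    rw [← integral_fderiv_tangential hinv hslice l, ← hS]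
    refine MeasureTheory.setIntegral_congr_fun hSc.measurableSet fun ω hω => ?_
    have h3 : HasFDerivAt (fun ω => (u, ω)) (ContinuousLinearMap.inr ℝ ℝ _) ω :=
      hasFDerivAt_prodMk_right u ω
    have h4 := ((hGd u ω hω).comp ω h3).fderiv
    simp only [Function.comp_def] at h4
    simp only [h4]
    simp
  rw [← add_zero (0 : ℂ), ← hA0]
  nth_rewrite 2 [hA0]
  rw [← hB0, ← MeasureTheory.integral_add hAi hBi]
  refine MeasureTheory.setIntegral_congr_fun hK.measurableSet fun p hp => ?_
  have hv : boostField l p = p.2 l • ((1 : ℝ), (0 : EuclideanSpace ℝ (Fin n))) +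
      (Real.sinh p.1 / Real.cosh p.1) •
        ((0 : ℝ), EuclideanSpace.single l (1 : ℝ) - p.2 l • p.2) := by
    simp [boostField]
  simp only [hA, hB, hv, map_add, map_smul, Complex.real_smul, hw, hth]
  ring

/-- The argument of the kernel along the curve in the crown. -/
noncomputable def crownArg (l : Fin n) (q : ℝ × ℝ × EuclideanSpace ℝ (Fin n)) : ℂ :=
  (1 - Complex.I * ((Real.cos q.1 : ℝ) : ℂ) * ((Real.sinh q.2.1 : ℝ) : ℂ) +
    ((Real.sin q.1 : ℝ) : ℂ) * ((Real.cosh q.2.1 : ℝ) : ℂ) * ((q.2.2 l : ℝ) : ℂ)) / 2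

lemma contDiff_crownArg (l : Fin n) : ContDiff ℝ 1 (crownArg l) := by
  have h1 : ContDiff ℝ 1
      (fun q : ℝ × ℝ × EuclideanSpace ℝ (Fin n) => ((Real.cos q.1 : ℝ) : ℂ)) :=
    Complex.ofRealCLM.contDiff.comp (Real.contDiff_cos.comp contDiff_fst)
  have h2 : ContDiff ℝ 1
      (fun q : ℝ × ℝ × EuclideanSpace ℝ (Fin n) => ((Real.sin q.1 : ℝ) : ℂ)) :=
    Complex.ofRealCLM.contDiff.comp (Real.contDiff_sin.comp contDiff_fst)
  have h3 : ContDiff ℝ 1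
      (fun q : ℝ × ℝ × EuclideanSpace ℝ (Fin n) => ((Real.sinh q.2.1 : ℝ) : ℂ)) :=
    Complex.ofRealCLM.contDiff.comp (Real.contDiff_sinh.comp (contDiff_fst.comp contDiff_snd))
  have h4 : ContDiff ℝ 1
      (fun q : ℝ × ℝ × EuclideanSpace ℝ (Fin n) => ((Real.cosh q.2.1 : ℝ) : ℂ)) :=
    Complex.ofRealCLM.contDiff.comp (Real.contDiff_cosh.comp (contDiff_fst.comp contDiff_snd))
  have h5 : ContDiff ℝ 1
      (fun q : ℝ × ℝ × EuclideanSpace ℝ (Fin n) => ((q.2.2 l : ℝ) : ℂ)) :=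
    Complex.ofRealCLM.contDiff.comp (by fun_prop)
  exact (((contDiff_const.sub ((contDiff_const.mul h1).mul h3)).add ((h2.mul h4).mul h5))).div_const _

/-- Moving along the curve amounts to `i` times the boost vector field. -/
lemma fderiv_crownArg (l : Fin n) (t : ℝ) (p : ℝ × EuclideanSpace ℝ (Fin n)) :
    fderiv ℝ (crownArg l) (t, p) (1, 0) =
      Complex.I * fderiv ℝ (crownArg l) (t, p) (0, boostField l p) := by
  obtain ⟨u, ω⟩ := p
  have hz := ((contDiff_crownArg l).differentiable (by norm_num) (t, u, ω)).hasFDerivAt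
  have hcurve : ∀ a b : ℝ, ∀ v : EuclideanSpace ℝ (Fin n),
      fderiv ℝ (crownArg l) (t, u, ω) (a, b, v) =
      (-(Complex.I * (((-Real.sin t * a : ℝ) : ℂ) * ((Real.sinh u : ℝ) : ℂ) +
        ((Real.cos t : ℝ) : ℂ) * ((Real.cosh u * b : ℝ) : ℂ))) +
      ((((Real.cos t * a : ℝ) : ℂ) * ((Real.cosh u : ℝ) : ℂ) +
        ((Real.sin t : ℝ) : ℂ) * ((Real.sinh u * b : ℝ) : ℂ)) * ((ω l : ℝ) : ℂ) +
        ((Real.sin t : ℝ) : ℂ) * ((Real.cosh u : ℝ) : ℂ) * ((v l : ℝ) : ℂ))) / 2 := by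
    intro a b v
    have ht : HasDerivAt (fun s : ℝ => t + s * a) a 0 := by
      simpa using ((hasDerivAt_id (0 : ℝ)).mul_const a).const_add t
    have hu : HasDerivAt (fun s : ℝ => u + s * b) b 0 := by
      simpa using ((hasDerivAt_id (0 : ℝ)).mul_const b).const_add u
    have hω : HasDerivAt (fun s : ℝ => ω + s • v) v 0 := by
      simpa using ((hasDerivAt_id (0 : ℝ)).smul_const v).const_add ω
    have hωl : HasDerivAt (fun s : ℝ => ω l + s * v l) (v l) 0 := by
      simpa using ((hasDerivAt_id (0 : ℝ)).mul_const (v l)).const_add (ω l)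
    have hline : HasDerivAt (fun s : ℝ => (t + s * a, u + s * b, ω + s • v)) (a, b, v) 0 :=
      ht.prodMk (hu.prodMk hω)
    have h0 : (t, u, ω) = (t + 0 * a, u + 0 * b, ω + (0 : ℝ) • v) := by simp
    have hz' : HasFDerivAt (crownArg l) (fderiv ℝ (crownArg l) (t, u, ω))
        (t + 0 * a, u + 0 * b, ω + (0 : ℝ) • v) := h0 ▸ hz
    have h1 := hz'.comp_hasDerivAt (0 : ℝ) hline
    have hc := ht.cos.ofReal_comp
    have hs := ht.sin.ofReal_comp
    have hch := hu.cosh.ofReal_comp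
    have hsh := hu.sinh.ofReal_comp
    have hx := hωl.ofReal_comp
    have h2 := ((((hc.mul hsh).const_mul Complex.I).const_sub 1).add
      ((hs.mul hch).mul hx)).div_const 2
    have h3 := h1.unique (h2.congr_of_eventuallyEq (Eventually.of_forall fun s => by
      simp only [Function.comp_def, crownArg, Pi.mul_apply, Pi.add_apply, PiLp.add_apply,
        PiLp.smul_apply, smul_eq_mul]
      ring))
    rw [h3]
    simp
  have hzero : ((1 : ℝ), (0 : ℝ × EuclideanSpace ℝ (Fin n))) =
    ((1 : ℝ), (0 : ℝ), (0 : EuclideanSpace ℝ (Fin n))) := rfl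
  rw [hzero, hcurve, boostField, hcurve]
  have hc : ((Real.cosh u : ℝ) : ℂ) ≠ 0 := Complex.ofReal_ne_zero.2 (Real.cosh_pos u).ne'
  simp only [PiLp.zero_apply, PiLp.smul_apply, PiLp.sub_apply, PiLp.single_apply, if_true,
    smul_eq_mul]
  push_cast at hc ⊢
  field_simp
  ring_nf
  simp only [Complex.I_sq]
  ring

lemma le_norm_one_sub_crownArg_mul (l : Fin n) {R t u : ℝ} (ht : t ∈ Set.Ioo 0 (Real.pi / 2))
    (hu : u ∈ Set.Icc (-R) R) {ω : EuclideanSpace ℝ (Fin n)}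
    (hω : ω ∈ Metric.sphere (0 : EuclideanSpace ℝ (Fin n)) 1) {τ : ℝ}
    (hτ : τ ∈ Set.Icc (0 : ℝ) 1) :
    Real.cos t ^ 4 / (4 * Real.cosh R) ≤ ‖1 - crownArg l (t, u, ω) * (τ : ℂ)‖ := by
  have hx : ω l ≤ 1 := by
    have := PiLp.norm_apply_le ω l
    rw [mem_sphere_zero_iff_norm.1 hω] at this
    exact (le_abs_self _).trans this
  have hε0 : 0 < Real.cos t := Real.cos_pos_of_mem_Ioo ⟨by linarith [ht.1, Real.pi_pos], ht.2⟩
  have hS0 : 0 < Real.sin t := Real.sin_pos_of_pos_of_lt_pi ht.1 (by linarith [ht.2, Real.pi_pos])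
  have hSε := Real.sin_sq_add_cos_sq t
  have hCs := Real.cosh_sq u
  have hC0 := Real.cosh_pos u
  have hM1 := Real.one_le_cosh R
  have hCM : Real.cosh u ≤ Real.cosh R := by
    rw [Real.cosh_le_cosh]
    exact (abs_le.2 hu).trans (le_abs_self _)
  have hre : (1 - crownArg l (t, u, ω) * (τ : ℂ)).re =
      1 - τ * (1 + Real.sin t * Real.cosh u * ω l) / 2 := by
    have : crownArg l (t, u, ω) = (((1 + Real.sin t * Real.cosh u * ω l) / 2 : ℝ) : ℂ) +
      ((-(Real.cos t * Real.sinh u) / 2 : ℝ) : ℂ) * Complex.I := by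
      simp only [crownArg]; push_cast; ring
    rw [this]
    simp [-Complex.ofReal_div, -Complex.ofReal_neg, -Complex.ofReal_mul, -Complex.ofReal_add]
    ring
  have him : (1 - crownArg l (t, u, ω) * (τ : ℂ)).im = τ * Real.cos t * Real.sinh u / 2 := by
    have : crownArg l (t, u, ω) = (((1 + Real.sin t * Real.cosh u * ω l) / 2 : ℝ) : ℂ) +
      ((-(Real.cos t * Real.sinh u) / 2 : ℝ) : ℂ) * Complex.I := by
      simp only [crownArg]; push_cast; ring
    rw [this]
    simp [-Complex.ofReal_div, -Complex.ofReal_neg, -Complex.ofReal_mul, -Complex.ofReal_add]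
    ring
  have hrn := (le_abs_self _).trans (Complex.abs_re_le_norm (1 - crownArg l (t, u, ω) * (τ : ℂ)))
  have hin := Complex.abs_im_le_norm (1 - crownArg l (t, u, ω) * (τ : ℂ))
  rw [hre] at hrn
  rw [him] at hin
  have hSC : Real.sin t * Real.cosh u * ω l ≤ Real.sin t * Real.cosh u :=
    mul_le_of_le_one_right (by positivity) hx
  set P := Real.sin t * Real.cosh u * ω l with hP
  set ε := Real.cos t with hε
  set M := Real.cosh R with hM
  set N := ‖1 - crownArg l (t, u, ω) * (τ : ℂ)‖ with hN
  have hε1 : ε ≤ 1 := Real.cos_le_one t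
  have hS1 : Real.sin t ≤ 1 := Real.sin_le_one t
  have hε2 : ε ^ 2 ≤ 1 := pow_le_one₀ hε0.le hε1
  have hε4 : ε ^ 4 ≤ ε ^ 2 := by nlinarith [sq_nonneg ε]
  have hle : ∀ y, ε ^ 4 / 4 ≤ y → ε ^ 4 / (4 * M) ≤ y := fun y hy =>
    (div_le_div_of_nonneg_left (by positivity) (by norm_num) (by linarith)).trans hy
  by_cases h1 : τ * (1 + P) ≤ 1
  · exact hle N (by linarith)
  push Not at h1
  have hP1 : 0 < 1 + P := by
    by_contra! hcon
    nlinarith [hτ.1]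
  have hP2 : 1 + P ≤ 2 * M := by nlinarith
  have hτM : 1 ≤ τ * (2 * M) := h1.le.trans (mul_le_mul_of_nonneg_left hP2 hτ.1)
  rcases le_or_gt ε |Real.sinh u| with h2 | h2
  · rw [div_le_iff₀ (by positivity)]
    have h3 : |τ * ε * Real.sinh u / 2| = τ * ε * |Real.sinh u| / 2 := by
      rw [abs_div, abs_mul, abs_mul, abs_of_nonneg hτ.1, abs_of_pos hε0, abs_two]
    rw [h3] at hin
    have h4 : τ * ε * ε ≤ 2 * N := by
      have := mul_le_mul_of_nonneg_left h2 (mul_nonneg hτ.1 hε0.le)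
      linarith
    nlinarith [mul_le_mul_of_nonneg_right h4 (by positivity : 0 ≤ 2 * M),
      mul_le_mul_of_nonneg_right hτM (sq_nonneg ε)]
  · have hs2 : Real.sinh u ^ 2 ≤ ε ^ 2 := by
      rw [← sq_abs]
      exact pow_le_pow_left₀ (abs_nonneg _) h2.le 2
    have hSC2 : Real.sin t * Real.cosh u ≤ 1 - ε ^ 4 / 2 := by
      refine abs_le_of_sq_le_sq' ?_ (by linarith) |>.2
      have h5 : (Real.sin t * Real.cosh u) ^ 2 = (1 - ε ^ 2) * (Real.sinh u ^ 2 + 1) := by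
        rw [mul_pow, hCs, ← hSε]; ring
      rw [h5]
      nlinarith [mul_le_mul_of_nonneg_left hs2 (by linarith : 0 ≤ 1 - ε ^ 2), sq_nonneg (ε ^ 4)]
    have h6 : τ * (1 + P) ≤ 1 + P := mul_le_of_le_one_left hP1.le hτ.2
    exact hle N (by linarith)

lemma crownArg_mem_compl_slit (l : Fin n) {t u : ℝ} (ht : t ∈ Set.Ioo 0 (Real.pi / 2))
    {ω : EuclideanSpace ℝ (Fin n)}
    (hω : ω ∈ Metric.sphere (0 : EuclideanSpace ℝ (Fin n)) 1) :
    crownArg l (t, u, ω) ∈ slitᶜ := by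
  rintro ⟨him, hre⟩
  have hε0 : 0 < Real.cos t := Real.cos_pos_of_mem_Ioo ⟨by linarith [ht.1, Real.pi_pos], ht.2⟩
  have h := le_norm_one_sub_crownArg_mul l ht (abs_le.1 le_rfl : u ∈ Set.Icc (-|u|) |u|) hω
    (τ := (crownArg l (t, u, ω)).re⁻¹)
    ⟨inv_nonneg.2 (by linarith), inv_le_one_of_one_le₀ hre⟩
  have hz : crownArg l (t, u, ω) = ((crownArg l (t, u, ω)).re : ℂ) :=
    Complex.ext (by simp) (by simp [him])
  have hne : ((crownArg l (t, u, ω)).re : ℂ) ≠ 0 := Complex.ofReal_ne_zero.2 (by linarith)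
  have h0 : 1 - crownArg l (t, u, ω) * (((crownArg l (t, u, ω)).re⁻¹ : ℝ) : ℂ) = 0 := by
    nth_rewrite 1 [hz]
    rw [Complex.ofReal_inv, mul_inv_cancel₀ hne, sub_self]
  rw [h0, norm_zero] at h
  have := Real.cosh_pos |u|
  have : 0 < Real.cos t ^ 4 / (4 * Real.cosh |u|) := by positivity
  linarith


/-- The pairing of a test function with the kernel along the curve in the crown. -/
noncomputable def crownPairing (σ : MeasureTheory.Measure (EuclideanSpace ℝ (Fin n))) (l : Fin n)
    (R : ℝ) (F : ℂ → ℂ) (ψ : ℝ × EuclideanSpace ℝ (Fin n) → ℂ) (t : ℝ) : ℂ :=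
  ∫ p in Set.Icc (-R) R ×ˢ Metric.sphere (0 : EuclideanSpace ℝ (Fin n)) 1,
    ψ p * F (crownArg l (t, p)) * ((Real.cosh p.1 : ℝ) : ℂ) ^ (n - 1)
      ∂(MeasureTheory.volume.prod σ)

lemma contDiffAt_comp_crownArg {F : ℂ → ℂ} (hF : DifferentiableOn ℂ F slitᶜ) (l : Fin n) {t u : ℝ}
    (ht : t ∈ Set.Ioo 0 (Real.pi / 2)) {ω : EuclideanSpace ℝ (Fin n)}
    (hω : ω ∈ Metric.sphere (0 : EuclideanSpace ℝ (Fin n)) 1) :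
    ContDiffAt ℝ 1 (fun q => F (crownArg l q)) (t, u, ω) := by
  have h1 : ContDiffAt ℂ 1 F (crownArg l (t, u, ω)) :=
    (hF.contDiffOn isOpen_compl_slit).contDiffAt
      (isOpen_compl_slit.mem_nhds (crownArg_mem_compl_slit l ht hω))
  exact (h1.restrict_scalars ℝ).comp (t, u, ω) (contDiff_crownArg l).contDiffAt

/-- Differentiating the pairing in the curve parameter amounts to differentiating the test
function along the boost vector field. -/
lemma hasDerivAt_crownPairing
    (hinv : ∀ f : EuclideanSpace ℝ (Fin n) ≃ₗᵢ[ℝ] EuclideanSpace ℝ (Fin n), σ.map f = σ)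
    {F : ℂ → ℂ} (hF : DifferentiableOn ℂ F slitᶜ) (l : Fin n) {R : ℝ} (hR : 0 ≤ R)
    {ψ : ℝ × EuclideanSpace ℝ (Fin n) → ℂ} (hψ : ContDiff ℝ 1 ψ)
    (hψ0 : ∀ ω, ψ (R, ω) = 0 ∧ ψ (-R, ω) = 0) {t : ℝ} (ht : t ∈ Set.Ioo 0 (Real.pi / 2)) :
    HasDerivAt (crownPairing σ l R F ψ)
      (crownPairing σ l R F (fun p => -Complex.I * fderiv ℝ ψ p (boostField l p)) t) t := by
  set S := Metric.sphere (0 : EuclideanSpace ℝ (Fin n)) 1 with hS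
  have hK : IsCompact (Set.Icc (-R) R ×ˢ S) := isCompact_Icc.prod (isCompact_sphere 0 1)
  have hw : ContDiff ℝ 1 (fun q : ℝ × ℝ × EuclideanSpace ℝ (Fin n) =>
      ((Real.cosh q.2.1 : ℝ) : ℂ) ^ (n - 1)) :=
    (Complex.ofRealCLM.contDiff.comp
      (Real.contDiff_cosh.comp (contDiff_fst.comp contDiff_snd))).pow _
  have hψ2 : ContDiff ℝ 1 (fun q : ℝ × ℝ × EuclideanSpace ℝ (Fin n) => ψ q.2) :=
    hψ.comp contDiff_snd
  have hA := hasDerivAt_setIntegral_of_contDiffAt (μ := MeasureTheory.volume.prod σ) hK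
    (isOpen_Ioo (a := 0) (b := Real.pi / 2))
    (H := fun q => ψ q.2 * F (crownArg l q) * ((Real.cosh q.2.1 : ℝ) : ℂ) ^ (n - 1))
    (fun s hs p hp => (hψ2.contDiffAt.mul (contDiffAt_comp_crownArg hF l hs hp.2)).mul
      hw.contDiffAt) ht
  refine hA.congr_deriv ?_
  have hGd : ∀ u, ∀ ω ∈ S, ContDiffAt ℝ 1 (fun p => ψ p * F (crownArg l (t, p))) (u, ω) := by
    intro u ω hω
    refine hψ.contDiffAt.mul ?_
    exact ContDiffAt.comp (f := fun p : ℝ × EuclideanSpace ℝ (Fin n) => (t, p))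
      (g := fun q => F (crownArg l q)) (u, ω) (contDiffAt_comp_crownArg hF l ht hω)
      (contDiffAt_const.prodMk contDiffAt_id)
  have hibp := integral_fderiv_boostField hinv hGd hR (fun ω => by simp [hψ0 ω]) l
  have hcF : ∀ p ∈ Set.Icc (-R) R ×ˢ S, ContinuousAt (fun p => F (crownArg l (t, p))) p := by
    intro p hp
    exact ContinuousAt.comp (f := fun p : ℝ × EuclideanSpace ℝ (Fin n) => (t, p))
      (g := fun q => F (crownArg l q)) (contDiffAt_comp_crownArg hF l ht hp.2).continuousAt
      (by fun_prop)
  have hwc : Continuous (fun p : ℝ × EuclideanSpace ℝ (Fin n) =>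
      ((Real.cosh p.1 : ℝ) : ℂ) ^ (n - 1)) := by fun_prop
  have hbc := (contDiff_boostField l).continuous
  have hi1 : MeasureTheory.IntegrableOn (fun p => ((Real.cosh p.1 : ℝ) : ℂ) ^ (n - 1) *
      fderiv ℝ (fun p => ψ p * F (crownArg l (t, p))) p (boostField l p)) (Set.Icc (-R) R ×ˢ S)
      (MeasureTheory.volume.prod σ) :=
    ContinuousOn.integrableOn_compact hK fun p hp => (hwc.continuousAt.mul
      ((((hGd p.1 p.2 hp.2).fderiv_right (m := 0) (by norm_num)).continuousAt).clm_apply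
        hbc.continuousAt)).continuousWithinAt
  have hi2 : MeasureTheory.IntegrableOn (fun p => -Complex.I * fderiv ℝ ψ p (boostField l p) *
      F (crownArg l (t, p)) * ((Real.cosh p.1 : ℝ) : ℂ) ^ (n - 1)) (Set.Icc (-R) R ×ˢ S)
      (MeasureTheory.volume.prod σ) :=
    ContinuousOn.integrableOn_compact hK fun p hp => (((continuousAt_const.mul
      ((hψ.continuous_fderiv (by norm_num)).clm_apply hbc).continuousAt).mul (hcF p hp)).mul
        hwc.continuousAt).continuousWithinAt
  have hsum := MeasureTheory.integral_add (hi1.const_mul Complex.I) hi2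
  rw [MeasureTheory.integral_const_mul, hibp, mul_zero, zero_add] at hsum
  refine Eq.trans ?_ hsum
  refine MeasureTheory.setIntegral_congr_fun hK.measurableSet fun p hp => ?_
  have hFz : HasFDerivAt F ((deriv F (crownArg l (t, p)) • (1 : ℂ →L[ℂ] ℂ)).restrictScalars ℝ)
      (crownArg l (t, p)) := by
    have h := (hF.differentiableAt (isOpen_compl_slit.mem_nhds
      (crownArg_mem_compl_slit l ht hp.2 (u := p.1)))).hasDerivAt
    exact (h.hasFDerivAt.congr_fderiv (by ext; simp)).restrictScalars ℝ
  have hz := ((contDiff_crownArg l).differentiable (by norm_num) (t, p)).hasFDerivAt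
  have hψp := (hψ.differentiable (by norm_num) p).hasFDerivAt
  have hinr : HasFDerivAt (fun p : ℝ × EuclideanSpace ℝ (Fin n) => (t, p))
      (ContinuousLinearMap.inr ℝ ℝ _) p := hasFDerivAt_prodMk_right t p
  have hline : HasDerivAt (fun s : ℝ => (s, p)) ((1 : ℝ), (0 : ℝ × EuclideanSpace ℝ (Fin n))) t :=
    (hasDerivAt_id t).prodMk (hasDerivAt_const t p)
  have hG := hψp.fun_mul (hFz.comp p (hz.comp p hinr))
  have hHd := (((hψ2.contDiffAt (x := (t, p))).mul (contDiffAt_comp_crownArg hF l ht hp.2)).mul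
      hw.contDiffAt).differentiableAt (by norm_num) |>.hasFDerivAt.comp_hasDerivAt t hline
  have hH2 := (((hFz.comp_hasDerivAt t (hz.comp_hasDerivAt t hline)).const_mul (ψ p)).mul_const
    (((Real.cosh p.1 : ℝ) : ℂ) ^ (n - 1)))
  have hH := hHd.unique hH2
  simp only [Function.comp_def] at hG
  refine hH.trans ?_
  simp only [hG.fderiv, fderiv_crownArg l t p]
  simp
  ring

/-- Kernels of moderate growth have boundary values along the curve. -/
lemma exists_tendsto_crownPairing
    (hinv : ∀ f : EuclideanSpace ℝ (Fin n) ≃ₗᵢ[ℝ] EuclideanSpace ℝ (Fin n), σ.map f = σ)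
    {F : ℂ → ℂ} (hF : DifferentiableOn ℂ F slitᶜ) {C r : ℝ} (hC : 0 ≤ C)
    (hFb : ∀ z : ℂ, ∀ δ : ℝ, 0 < δ →
      (∀ t ∈ Set.Icc (0 : ℝ) 1, δ ≤ ‖1 - z * (t : ℂ)‖) → ‖F z‖ ≤ C * δ ^ (-r))
    (l : Fin n) {R : ℝ} (hR : 0 ≤ R) {ψ : ℝ × EuclideanSpace ℝ (Fin n) → ℂ}
    (hψ : ContDiff ℝ (⊤ : ℕ∞) ψ) (hψR : tsupport ψ ⊆ {p | p.1 ∈ Set.Ioo (-R) R}) :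
    ∃ L, Tendsto (crownPairing σ l R F ψ) (𝓝[<] (Real.pi / 2)) (𝓝 L) := by
  set S := Metric.sphere (0 : EuclideanSpace ℝ (Fin n)) 1 with hS
  have hK : IsCompact (Set.Icc (-R) R ×ˢ S) := isCompact_Icc.prod (isCompact_sphere 0 1)
  set D : (ℝ × EuclideanSpace ℝ (Fin n) → ℂ) → ℝ × EuclideanSpace ℝ (Fin n) → ℂ :=
    fun ψ p => -Complex.I * fderiv ℝ ψ p (boostField l p) with hD
  have hiter : ∀ k, ContDiff ℝ (⊤ : ℕ∞) (D^[k] ψ) ∧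
      tsupport (D^[k] ψ) ⊆ {p | p.1 ∈ Set.Ioo (-R) R} := by
    intro k
    induction k with
    | zero => exact ⟨hψ, hψR⟩
    | succ k ih =>
      rw [Function.iterate_succ_apply']
      refine ⟨contDiff_const.mul ((ih.1.fderiv_right (m := (⊤ : ℕ∞)) (by simp)).clm_apply
        (contDiff_boostField l)), ?_⟩
      refine (closure_mono ?_).trans ((tsupport_fderiv_subset ℝ).trans ih.2)
      intro p hp
      contrapose! hp
      simp only [Function.mem_support, not_not] at hp
      rw [Function.notMem_support]
      show -Complex.I * fderiv ℝ (D^[k] ψ) p (boostField l p) = 0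
      rw [hp]
      simp
  have hzero : ∀ k ω, (D^[k] ψ) (R, ω) = 0 ∧ (D^[k] ψ) (-R, ω) = 0 := by
    refine fun k ω => ⟨?_, ?_⟩ <;> by_contra h <;>
      simpa using (hiter k).2 (subset_tsupport _ (Function.mem_support.2 h))
  have hpi : (1 : ℝ) < Real.pi / 2 := by linarith [Real.pi_gt_three]
  have hsub : ∀ t ∈ Set.Ico (Real.pi / 2 - 1) (Real.pi / 2), t ∈ Set.Ioo 0 (Real.pi / 2) :=
    fun t ht => ⟨by linarith [ht.1], ht.2⟩
  refine exists_tendsto_of_deriv_power_bounds (f := fun k => crownPairing σ l R F (D^[k] ψ))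
    (a := Real.pi / 2 - 1) (by linarith) (fun k t ht => ?_) ⌈4 * r⌉₊ (fun k => ?_)
  · rw [Function.iterate_succ_apply']
    exact hasDerivAt_crownPairing hinv hF l hR ((hiter k).1.of_le (by simp)) (hzero k) (hsub t ht)
  · have hcont : Continuous fun p : ℝ × EuclideanSpace ℝ (Fin n) =>
        (D^[k] ψ) p * ((Real.cosh p.1 : ℝ) : ℂ) ^ (n - 1) :=
      (hiter k).1.continuous.mul (by fun_prop)
    obtain ⟨M, hM⟩ := hK.exists_bound_of_continuousOn hcont.continuousOn
    set A : ℝ := (2 / Real.pi) ^ 4 / (4 * Real.cosh R) with hA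
    have hA0 : 0 < A := by
      have := Real.cosh_pos R
      have := Real.pi_pos
      positivity
    refine ⟨|M| * (C * A ^ (-r)) * (MeasureTheory.volume.prod σ).real (Set.Icc (-R) R ×ˢ S),
      fun t ht => ?_⟩
    have hx : 0 < Real.pi / 2 - t := sub_pos.2 ht.2
    have hx1 : Real.pi / 2 - t ≤ 1 := by linarith [ht.1]
    have hkey : ∀ p ∈ Set.Icc (-R) R ×ˢ S,
        ‖(D^[k] ψ) p * F (crownArg l (t, p)) * ((Real.cosh p.1 : ℝ) : ℂ) ^ (n - 1)‖ ≤
        |M| * (C * A ^ (-r)) * (Real.pi / 2 - t) ^ (-((⌈4 * r⌉₊ : ℝ) + 1 / 2)) := by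
      intro p hp
      have hcos : 2 / Real.pi * (Real.pi / 2 - t) ≤ Real.cos t := by
        rw [← Real.sin_pi_div_two_sub]
        exact Real.mul_le_sin hx.le (by linarith [ht.1])
      have hb := hFb (crownArg l (t, p)) (A * (Real.pi / 2 - t) ^ 4) (by positivity)
        (fun τ hτ => le_trans ?_ (le_norm_one_sub_crownArg_mul l (hsub t ht) hp.1 hp.2 hτ))
      · have hpow : (A * (Real.pi / 2 - t) ^ 4) ^ (-r) ≤
            A ^ (-r) * (Real.pi / 2 - t) ^ (-((⌈4 * r⌉₊ : ℝ) + 1 / 2)) := by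
          rw [Real.mul_rpow hA0.le (by positivity), ← Real.rpow_natCast, ← Real.rpow_mul hx.le]
          refine mul_le_mul_of_nonneg_left (Real.rpow_le_rpow_of_exponent_ge hx hx1 ?_)
            (Real.rpow_nonneg hA0.le _)
          have := Nat.le_ceil (4 * r)
          push_cast
          linarith
        calc ‖(D^[k] ψ) p * F (crownArg l (t, p)) * ((Real.cosh p.1 : ℝ) : ℂ) ^ (n - 1)‖
            = ‖(D^[k] ψ) p * ((Real.cosh p.1 : ℝ) : ℂ) ^ (n - 1)‖ * ‖F (crownArg l (t, p))‖ := by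
              rw [← norm_mul]; congr 1; ring
          _ ≤ |M| * (C * (A ^ (-r) * (Real.pi / 2 - t) ^ (-((⌈4 * r⌉₊ : ℝ) + 1 / 2)))) :=
              mul_le_mul ((hM p hp).trans (le_abs_self M))
                (hb.trans (mul_le_mul_of_nonneg_left hpow hC)) (norm_nonneg _) (abs_nonneg _)
          _ = _ := by ring
      · rw [hA, div_mul_eq_mul_div, ← mul_pow]
        have := Real.cosh_pos R
        have := Real.pi_pos
        gcongr
    refine (MeasureTheory.norm_setIntegral_le_of_norm_le_const hK.measure_lt_top hkey).trans
      (le_of_eq ?_)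
    ring

/-- The iterated integral over de Sitter space as an integral over a compact set. -/
lemma iteratedIntegral_eq_crownPairing
    (hsupp : σ (Metric.sphere (0 : EuclideanSpace ℝ (Fin n)) 1)ᶜ = 0)
    {F : ℂ → ℂ} (hF : DifferentiableOn ℂ F slitᶜ) (l : Fin n) {R : ℝ}
    {ψ : ℝ × EuclideanSpace ℝ (Fin n) → ℂ} (hψ : Continuous ψ)
    (hψR : ∀ p, p.1 ∉ Set.Icc (-R) R → ψ p = 0) {t : ℝ} (ht : t ∈ Set.Ioo 0 (Real.pi / 2)) :
    ∫ u : ℝ, ∫ ω, ψ (u, ω) * F (crownArg l (t, u, ω)) * ((Real.cosh u : ℝ) : ℂ) ^ (n - 1) ∂σ =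
      crownPairing σ l R F ψ t := by
  set S := Metric.sphere (0 : EuclideanSpace ℝ (Fin n)) 1 with hS
  have hSm : MeasurableSet S := (isCompact_sphere 0 1).measurableSet
  have hK : IsCompact (Set.Icc (-R) R ×ˢ S) := isCompact_Icc.prod (isCompact_sphere 0 1)
  have hσ : σ.restrict S = σ := MeasureTheory.Measure.restrict_eq_self_of_ae_mem
    (MeasureTheory.mem_ae_iff.2 hsupp)
  have hint : MeasureTheory.IntegrableOn (fun p : ℝ × EuclideanSpace ℝ (Fin n) =>
      ψ p * F (crownArg l (t, p)) * ((Real.cosh p.1 : ℝ) : ℂ) ^ (n - 1))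
      (Set.Icc (-R) R ×ˢ S) (MeasureTheory.volume.prod σ) := by
    refine ContinuousOn.integrableOn_compact hK fun p hp => ?_
    have h1 : ContinuousAt (fun p => F (crownArg l (t, p))) p :=
      ContinuousAt.comp (f := fun p : ℝ × EuclideanSpace ℝ (Fin n) => (t, p))
        (g := fun q => F (crownArg l q)) (contDiffAt_comp_crownArg hF l ht hp.2).continuousAt
        (by fun_prop)
    have h2 : Continuous (fun p : ℝ × EuclideanSpace ℝ (Fin n) =>
      ((Real.cosh p.1 : ℝ) : ℂ) ^ (n - 1)) := by fun_prop
    exact ((hψ.continuousAt.mul h1).mul h2.continuousAt).continuousWithinAt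
  rw [crownPairing, MeasureTheory.setIntegral_prod _ hint, hσ]
  refine (MeasureTheory.setIntegral_eq_integral_of_forall_compl_eq_zero fun u hu => ?_).symm
  simp [hψR (u, _) hu]

lemma lformC_zCurve_s18 (hn : 0 < n) (t u : ℝ) (ω : EuclideanSpace ℝ (Fin n)) :
    (1 + lformC n (zCurve n t) (fun i => (((Fin.cons (Real.sinh u)
      (fun j => Real.cosh u * ω j) : Fin (n+1) → ℝ) i : ℝ) : ℂ))) / 2 =
      crownArg ⟨n - 1, Nat.sub_lt hn one_pos⟩ (t, u, ω) := by
  set l : Fin n := ⟨n - 1, Nat.sub_lt hn one_pos⟩ with hl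
  have hlast : ∀ j : Fin n, j.succ = Fin.last n ↔ j = l := by
    intro j
    rw [Fin.ext_iff, Fin.ext_iff, Fin.val_succ, Fin.val_last, hl]
    simp only
    omega
  have h : lformC n (zCurve n t) (fun i => (((Fin.cons (Real.sinh u)
      (fun j => Real.cosh u * ω j) : Fin (n+1) → ℝ) i : ℝ) : ℂ)) =
      -(Complex.I * (Real.cos t : ℂ)) * (Real.sinh u : ℂ) +
        (Real.sin t : ℂ) * ((Real.cosh u * ω l : ℝ) : ℂ) := by
    have hz0 : zCurve n t 0 = Complex.I * (Real.cos t : ℂ) := by simp [zCurve]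
    have hz : zCurve n t l.succ = (Real.sin t : ℂ) := by
      simp only [zCurve]
      rw [if_neg (Fin.succ_ne_zero l), if_pos ((hlast l).2 rfl)]
    rw [lformC, Fin.sum_univ_succ, Finset.sum_eq_single l]
    · simp [hz, hz0]
    · intro j _ hj
      have : ¬ j.succ = Fin.last n := fun h => hj ((hlast j).1 h)
      simp [zCurve, this]
    · simp
  rw [h, crownArg]
  push_cast
  ring

end DeSitter

open Filter Topology in
theorem stmt18 (n : ℕ) (hn : 2 ≤ n) (lam : ℂ) (hlam : admissible n lam)
    (σ : MeasureTheory.Measure (EuclideanSpace ℝ (Fin n)))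
    [MeasureTheory.IsFiniteMeasure σ] (hσne : σ ≠ 0)
    (hsupp : σ (Metric.sphere (0 : EuclideanSpace ℝ (Fin n)) 1)ᶜ = 0)
    (hinv : ∀ f : EuclideanSpace ℝ (Fin n) ≃ₗᵢ[ℝ] EuclideanSpace ℝ (Fin n),
      σ.map f = σ)
    (φ : ℝ × EuclideanSpace ℝ (Fin n) → ℂ) (hφ : ContDiff ℝ (⊤ : ℕ∞) φ)
    (hφc : HasCompactSupport φ) :
    ∃ L : ℂ,
      Tendsto (fun t : ℝ => ∫ u : ℝ, ∫ ω, (starRingEnd ℂ) (φ (u, ω)) *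
          Flam n lam ((1 + lformC n (zCurve n t)
            (fun i => (((Fin.cons (Real.sinh u) (fun j => Real.cosh u * ω j) : Fin (n+1) → ℝ) i : ℝ) : ℂ)))/2) *
          ((Real.cosh u : ℝ) : ℂ) ^ (n - 1) ∂σ)
        (𝓝[<] (Real.pi/2)) (𝓝 L) := by
  have hn2 : (2 : ℝ) ≤ n := by exact_mod_cast hn
  have hlam1 : lam.re < ((n : ℝ) - 1) / 2 := by
    rcases hlam with h | h
    · rw [h.1]; linarith
    · exact h.2.2
  have hlam0 : 0 ≤ lam.re := by
    rcases hlam with h | h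
    · exact h.1.ge
    · exact h.2.1.le
  have hF := differentiableOn_Flam hlam1 hlam0
  obtain ⟨C, r, hC, hb⟩ := exists_norm_Flam_le hlam1 hlam0
  obtain ⟨R, hR0, hR⟩ : ∃ R : ℝ, 0 < R ∧ ∀ p ∈ tsupport φ, ‖p‖ < R := by
    obtain ⟨R, hR⟩ := hφc.isCompact.isBounded.exists_norm_le
    exact ⟨|R| + 1, by positivity, fun p hp => by linarith [hR p hp, le_abs_self R]⟩
  set ψ : ℝ × EuclideanSpace ℝ (Fin n) → ℂ := fun p => (starRingEnd ℂ) (φ p) with hψ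
  have hψs : ContDiff ℝ (⊤ : ℕ∞) ψ := Complex.conjCLE.contDiff.comp hφ
  have hsub : tsupport ψ ⊆ {p | p.1 ∈ Set.Ioo (-R) R} := by
    intro p hp
    have hp' : p ∈ tsupport φ := tsupport_comp_subset (map_zero (starRingEnd ℂ)) φ hp
    exact abs_lt.1 ((norm_fst_le p).trans_lt (hR p hp'))
  have hzero : ∀ p : ℝ × EuclideanSpace ℝ (Fin n), p.1 ∉ Set.Icc (-R) R → ψ p = 0 := by
    intro p hp
    by_contra h
    exact hp (Set.Ioo_subset_Icc_self (hsub (subset_tsupport _ (Function.mem_support.2 h))))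
  have hn0 : 0 < n := by omega
  obtain ⟨L, hL⟩ := exists_tendsto_crownPairing hinv hF hC hb
    ⟨n - 1, Nat.sub_lt hn0 one_pos⟩ hR0.le hψs hsub
  refine ⟨L, hL.congr' ?_⟩
  have hpi : (0 : ℝ) < Real.pi / 2 := by positivity
  filter_upwards [Ioo_mem_nhdsLT hpi] with t ht
  simp only [lformC_zCurve_s18 hn0]
  exact (iteratedIntegral_eq_crownPairing hsupp hF _ hψs.continuous hzero ht).symm
end
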